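/- arXiv:1506.00089 — 5 statements merged into one kernel-verified Lean document; each statement's English description precedes it below -/
import Mathlib

section
/- Let d ∈ (0,1) and r > 0. Then there exists a unique c ∈ (0, a_d) such that ∫ (c/(x−c))² ϱ_d(x) dx = r, where the integral is over [a_d, b_d]. -/
open MeasureTheory Filter

/-- Left edge of the Marchenko–Pastur type law with ratio `d`. -/
noncomputable def aMP (d : ℝ) : ℝ := (1 - Real.sqrt d) ^ 2

/-- Right edge of the Marchenko–Pastur type law with ratio `d`. -/
noncomputable def bMP (d : ℝ) : ℝ := (1 + Real.sqrt d) ^ 2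

/-- The Marchenko–Pastur type density `ϱ_d`. -/
noncomputable def rhoMP (d x : ℝ) : ℝ :=
  if aMP d ≤ x ∧ x ≤ bMP d then
    (1 / (2 * Real.pi * d * x)) * Real.sqrt ((bMP d - x) * (x - aMP d))
  else 0

section WeightedSquare

variable {a b m k r : ℝ} {g : ℝ → ℝ}

lemma continuousOn_sq_div_mul (hg : ContinuousOn g (Set.Icc a b)) {c : ℝ} (hc : c < a) :
    ContinuousOn (fun x => (c / (x - c)) ^ 2 * g x) (Set.Icc a b) := by
  refine ContinuousOn.mul (ContinuousOn.pow (ContinuousOn.div continuousOn_const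
    (by fun_prop) ?_) 2) hg
  intro x hx
  have := hx.1
  exact (by linarith : 0 < x - c).ne'

lemma continuousOn_integral_sq_div_mul (hab : a < b) (hg : ContinuousOn g (Set.Icc a b))
    {c₁ : ℝ} (hc₁ : c₁ < a) :
    ContinuousOn (fun c => ∫ x in a..b, (c / (x - c)) ^ 2 * g x) (Set.Iic c₁) := by
  set G : ℝ → ℝ := Set.IccExtend hab.le ((Set.Icc a b).domRestrict g) with hG
  have hGc : Continuous G := (continuousOn_iff_continuous_domRestrict.1 hg).Icc_extend'
  have hcont : Continuous (fun c => ∫ x in a..b,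
      (min c c₁ / (max x a - min c c₁)) ^ 2 * G x) := by
    apply intervalIntegral.continuous_parametric_intervalIntegral_of_continuous'
    refine Continuous.mul (Continuous.pow (Continuous.div (by fun_prop) (by fun_prop) ?_) 2)
      (hGc.comp continuous_snd)
    rintro ⟨c, x⟩
    have h₁ := le_max_right x a
    have h₂ := min_le_right c c₁
    exact (by linarith : 0 < max x a - min c c₁).ne'
  refine hcont.continuousOn.congr fun c hc => ?_
  refine intervalIntegral.integral_congr fun x hx => ?_
  rw [Set.uIcc_of_le hab.le] at hx
  have hx' : G x = g x := by rw [hG, Set.IccExtend_of_mem _ _ hx]; rfl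
  simp only [hx', min_eq_left (Set.mem_Iic.1 hc), max_eq_left hx.1]

lemma integral_sq_div_mul_lt (hab : a < b) (hg : ContinuousOn g (Set.Icc a b))
    (hpos : ∀ x ∈ Set.Ioo a b, 0 < g x) (hnonneg : ∀ x ∈ Set.Icc a b, 0 ≤ g x)
    {c c' : ℝ} (hc : 0 < c) (hcc' : c < c') (hc' : c' < a) :
    ∫ x in a..b, (c / (x - c)) ^ 2 * g x < ∫ x in a..b, (c' / (x - c')) ^ 2 * g x := by
  have key : ∀ x, a ≤ x → (c / (x - c)) ^ 2 < (c' / (x - c')) ^ 2 := by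
    intro x hx
    have h₁ : 0 < x - c := by linarith
    have h₂ : 0 < x - c' := by linarith
    have h₃ : c / (x - c) < c' / (x - c') := by
      rw [div_lt_div_iff₀ h₁ h₂]
      nlinarith
    have h₄ : 0 < c / (x - c) := div_pos hc h₁
    exact pow_lt_pow_left₀ h₃ h₄.le two_ne_zero
  refine intervalIntegral.integral_lt_integral_of_continuousOn_of_le_of_exists_lt hab
    (continuousOn_sq_div_mul hg (hcc'.trans hc')) (continuousOn_sq_div_mul hg hc') ?_ ?_
  · intro x hx
    exact mul_le_mul_of_nonneg_right (key x hx.1.le).le (hnonneg x ⟨hx.1.le, hx.2⟩)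
  · have hmid : (a + b) / 2 ∈ Set.Ioo a b := ⟨by linarith, by linarith⟩
    exact ⟨_, Set.Ioo_subset_Icc_self hmid,
      mul_lt_mul_of_pos_right (key _ hmid.1.le) (hpos _ hmid)⟩

lemma exists_le_integral_sq_div_mul (ha : 0 < a) (ham : a < m) (hmb : m ≤ b) (hk : 0 < k)
    (hr : 0 < r) (hg : ContinuousOn g (Set.Icc a b)) (hnonneg : ∀ x ∈ Set.Icc a b, 0 ≤ g x)
    (hlow : ∀ x ∈ Set.Icc a m, k * Real.sqrt (x - a) ≤ g x) :
    ∃ c ∈ Set.Ioo 0 a, r ≤ ∫ x in a..b, (c / (x - c)) ^ 2 * g x := by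
  obtain ⟨s, hs, hs₁, hs₂, hs₃⟩ : ∃ s : ℝ, 0 < s ∧ 2 * s ^ 2 ≤ a / 2 ∧ 2 * s ^ 2 ≤ m - a ∧
      64 * r * s ≤ a ^ 2 * k := by
    have hma : 0 < m - a := sub_pos.2 ham
    refine ⟨min (min 1 (a / 4)) (min ((m - a) / 2) (a ^ 2 * k / (64 * r))),
      by positivity, ?_⟩
    set s := min (min 1 (a / 4)) (min ((m - a) / 2) (a ^ 2 * k / (64 * r))) with hs
    have hs0 : 0 < s := by positivity
    have h₁ : s ≤ 1 := (min_le_left _ _).trans (min_le_left _ _)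
    have h₂ : s ≤ a / 4 := (min_le_left _ _).trans (min_le_right _ _)
    have h₃ : s ≤ (m - a) / 2 := (min_le_right _ _).trans (min_le_left _ _)
    have h₄ : s ≤ a ^ 2 * k / (64 * r) := (min_le_right _ _).trans (min_le_right _ _)
    rw [le_div_iff₀ (by positivity)] at h₄
    exact ⟨by nlinarith, by nlinarith, by linarith⟩
  have hs2 : 0 < s ^ 2 := by positivity
  refine ⟨a - 2 * s ^ 2, ⟨by linarith, by linarith⟩, ?_⟩
  set c := a - 2 * s ^ 2 with hc
  have hca : c < a := by linarith
  have hint : IntervalIntegrable (fun x => (c / (x - c)) ^ 2 * g x) volume a b :=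
    (continuousOn_sq_div_mul hg hca).intervalIntegrable_of_Icc (by linarith)
  have hsub : ∫ x in (a + s ^ 2)..(a + 2 * s ^ 2), (c / (x - c)) ^ 2 * g x ≤
      ∫ x in a..b, (c / (x - c)) ^ 2 * g x := by
    refine intervalIntegral.integral_mono_interval (by linarith) (by linarith) (by linarith)
      ?_ hint
    refine (ae_restrict_iff' measurableSet_Ioc).2 (Eventually.of_forall fun x hx => ?_)
    exact mul_nonneg (sq_nonneg _) (hnonneg x ⟨hx.1.le, hx.2⟩)
  refine le_trans ?_ hsub
  have hconst : ∫ _x in (a + s ^ 2)..(a + 2 * s ^ 2), ((a / 2) / (4 * s ^ 2)) ^ 2 * (k * s) ≤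
      ∫ x in (a + s ^ 2)..(a + 2 * s ^ 2), (c / (x - c)) ^ 2 * g x := by
    refine intervalIntegral.integral_mono_on (by linarith) (by simp) ?_ ?_
    · refine hint.mono_set ?_
      rw [Set.uIcc_of_le (by linarith), Set.uIcc_of_le (by linarith)]
      exact Set.Icc_subset_Icc (by linarith) (by linarith)
    · intro x hx
      have hx₁ := hx.1
      have hx₂ := hx.2
      have h₁ : 0 < x - c := by linarith
      have h₂ : s ≤ Real.sqrt (x - a) := Real.le_sqrt_of_sq_le (by linarith)
      have h₃ : k * s ≤ g x :=
        (mul_le_mul_of_nonneg_left h₂ hk.le).trans (hlow x ⟨by linarith, by linarith⟩)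
      have h₄ : (a / 2) / (4 * s ^ 2) ≤ c / (x - c) :=
        div_le_div₀ (by linarith) (by linarith) h₁ (by linarith)
      gcongr
  refine le_trans ?_ hconst
  rw [intervalIntegral.integral_const, smul_eq_mul]
  have : (a + 2 * s ^ 2 - (a + s ^ 2)) * ((a / 2 / (4 * s ^ 2)) ^ 2 * (k * s)) =
      a ^ 2 * k / (64 * s) := by
    field_simp
    ring
  rw [this, le_div_iff₀ (by positivity)]
  linarith

lemma existsUnique_integral_sq_div_mul_eq (ha : 0 < a) (ham : a < m) (hmb : m ≤ b)
    (hk : 0 < k) (hr : 0 < r) (hg : ContinuousOn g (Set.Icc a b))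
    (hpos : ∀ x ∈ Set.Ioo a b, 0 < g x) (hnonneg : ∀ x ∈ Set.Icc a b, 0 ≤ g x)
    (hlow : ∀ x ∈ Set.Icc a m, k * Real.sqrt (x - a) ≤ g x) :
    ∃! c : ℝ, c ∈ Set.Ioo 0 a ∧ (∫ x in a..b, (c / (x - c)) ^ 2 * g x) = r := by
  have hab : a < b := ham.trans_le hmb
  obtain ⟨c₁, hc₁, hrc₁⟩ := exists_le_integral_sq_div_mul ha ham hmb hk hr hg hnonneg hlow
  have hcont := (continuousOn_integral_sq_div_mul hab hg hc₁.2).mono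
    (Set.Icc_subset_Iic_self : Set.Icc 0 c₁ ⊆ Set.Iic c₁)
  obtain ⟨c, hc, hcr⟩ := intermediate_value_Icc hc₁.1.le hcont ⟨by simpa using hr.le, hrc₁⟩
  dsimp only at hcr
  have hc0 : c ≠ 0 := by
    rintro rfl
    simp at hcr
    exact hr.ne hcr
  refine ⟨c, ⟨⟨lt_of_le_of_ne hc.1 hc0.symm, hc.2.trans_lt hc₁.2⟩, hcr⟩, ?_⟩
  rintro c' ⟨hc', hcr'⟩
  rcases lt_trichotomy c' c with h | h | h
  · have := integral_sq_div_mul_lt hab hg hpos hnonneg hc'.1 h (hc.2.trans_lt hc₁.2)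
    linarith
  · exact h
  · have := integral_sq_div_mul_lt hab hg hpos hnonneg
      (lt_of_le_of_ne hc.1 hc0.symm) h hc'.2
    linarith

end WeightedSquare

lemma aMP_pos {d : ℝ} (hd : d < 1) : 0 < aMP d := by
  have : Real.sqrt d < 1 := by rw [Real.sqrt_lt' one_pos]; simpa using hd
  exact pow_pos (sub_pos.2 this) 2

lemma aMP_lt_bMP {d : ℝ} (hd : 0 < d) : aMP d < bMP d := by
  have := Real.sqrt_pos.2 hd
  unfold aMP bMP
  nlinarith

lemma rhoMP_of_mem {d x : ℝ} (hx : x ∈ Set.Icc (aMP d) (bMP d)) :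
    rhoMP d x = (1 / (2 * Real.pi * d * x)) * Real.sqrt ((bMP d - x) * (x - aMP d)) :=
  if_pos hx

lemma continuousOn_rhoMP {d : ℝ} (hd : d ∈ Set.Ioo (0 : ℝ) 1) :
    ContinuousOn (rhoMP d) (Set.Icc (aMP d) (bMP d)) := by
  refine ContinuousOn.congr (ContinuousOn.mul (ContinuousOn.div continuousOn_const
    (by fun_prop) fun x hx => ?_) (by fun_prop)) fun x hx => rhoMP_of_mem hx
  have hx0 : 0 < x := (aMP_pos hd.2).trans_le hx.1
  have := hd.1
  positivity

lemma rhoMP_nonneg {d x : ℝ} (hd : d ∈ Set.Ioo (0 : ℝ) 1)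
    (hx : x ∈ Set.Icc (aMP d) (bMP d)) : 0 ≤ rhoMP d x := by
  have hx0 : 0 < x := (aMP_pos hd.2).trans_le hx.1
  have := hd.1
  rw [rhoMP_of_mem hx]
  positivity

lemma rhoMP_pos {d x : ℝ} (hd : d ∈ Set.Ioo (0 : ℝ) 1)
    (hx : x ∈ Set.Ioo (aMP d) (bMP d)) : 0 < rhoMP d x := by
  have hx0 : 0 < x := (aMP_pos hd.2).trans hx.1
  have := hd.1
  have h₁ := sub_pos.2 hx.1
  have h₂ := sub_pos.2 hx.2
  rw [rhoMP_of_mem (Set.Ioo_subset_Icc_self hx)]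
  positivity

lemma mul_sqrt_le_rhoMP {d x : ℝ} (hd : d ∈ Set.Ioo (0 : ℝ) 1)
    (hx : x ∈ Set.Icc (aMP d) ((aMP d + bMP d) / 2)) :
    1 / (2 * Real.pi * d * bMP d) * Real.sqrt ((bMP d - aMP d) / 2) * Real.sqrt (x - aMP d) ≤
      rhoMP d x := by
  have hx₁ := hx.1
  have hx₂ := hx.2
  have hab := aMP_lt_bMP hd.1
  have hx0 : 0 < x := (aMP_pos hd.2).trans_le hx.1
  have hd0 := hd.1
  have hxb : x ≤ bMP d := by linarith
  have hxa : 0 ≤ x - aMP d := sub_nonneg.2 hx.1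
  rw [rhoMP_of_mem ⟨hx.1, hxb⟩, mul_assoc, ← Real.sqrt_mul (by linarith)]
  have : (bMP d - aMP d) / 2 ≤ bMP d - x := by linarith
  gcongr

/-- for `d ∈ (0,1)` and `r > 0` there is a unique `c ∈ (0, a_d)` with
`∫ (c/(x−c))² ϱ_d(x) dx = r`, the integral being over `[a_d, b_d]`. -/
theorem stmt_0 (d r : ℝ) (hd : d ∈ Set.Ioo (0 : ℝ) 1) (hr : 0 < r) :
    ∃! c : ℝ, c ∈ Set.Ioo 0 (aMP d) ∧
      (∫ x in (aMP d)..(bMP d), (c / (x - c)) ^ 2 * rhoMP d x) = r := by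
  have hab := aMP_lt_bMP hd.1
  have ha := aMP_pos hd.2
  have hk : 0 < 1 / (2 * Real.pi * d * bMP d) * Real.sqrt ((bMP d - aMP d) / 2) := by
    have hd0 := hd.1
    have hb := ha.trans hab
    have hba := sub_pos.2 hab
    positivity
  exact existsUnique_integral_sq_div_mul_eq ha (by linarith) (by linarith) hk hr
    (continuousOn_rhoMP hd) (fun x hx => rhoMP_pos hd hx) (fun x hx => rhoMP_nonneg hd hx)
    (fun x hx => mul_sqrt_le_rhoMP hd hx)
end

section
/- Let p < m be positive integers and set d = p/m, a_p = a_d. Then c = (m−p)²/(2(m+p)m) lies in (0, a_p) and satisfies ∫ (c/(x−c))² ϱ_d(x) dx = 1 (so c is the unique such solution c_p when n = p); moreover c_p/a_p = (√m+√p)²/(2(m+p)) < 1. -/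
open MeasureTheory Filter

/-- The substitution `u = √((x - a) / (b - x))` rationalises `1 / ((x - z) √((x - a) (b - x)))`. -/
theorem hasDerivAt_arctan_mul_sqrt_div_sqrt {a b z R x : ℝ} (hz : z < a)
    (hR2 : R ^ 2 = (a - z) * (b - z)) (hax : a < x) (hxb : x < b) :
    HasDerivAt (fun y => Real.arctan (R / (a - z) * (√(y - a) / √(b - y))))
      (R / (2 * (x - z) * (√(x - a) * √(b - x)))) x := by
  have hs0 : 0 < x - a := sub_pos.2 hax
  have ht0 : 0 < b - x := sub_pos.2 hxb
  have hs := Real.sqrt_pos.2 hs0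
  have ht := Real.sqrt_pos.2 ht0
  have hs2 := Real.sq_sqrt hs0.le
  have ht2 := Real.sq_sqrt ht0.le
  have ds : HasDerivAt (fun y => √(y - a)) (1 / (2 * √(x - a))) x :=
    ((hasDerivAt_id x).sub_const a).sqrt hs0.ne'
  have dt : HasDerivAt (fun y => √(b - y)) (-1 / (2 * √(b - x))) x :=
    ((hasDerivAt_id x).const_sub b).sqrt ht0.ne'
  have h := ((ds.div dt ht.ne').const_mul (R / (a - z))).arctan
  refine h.congr_deriv ?_
  simp only [Pi.div_apply]
  have hk : 1 + (R / (a - z) * (√(x - a) / √(b - x))) ^ 2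
      = (b - a) * (x - z) / ((a - z) * (b - x)) := by
    have : a - z ≠ 0 := by linarith
    rw [mul_pow, div_pow, div_pow, hs2, ht2, hR2]
    field_simp
    ring
  have hu : (1 / (2 * √(x - a)) * √(b - x) - √(x - a) * (-1 / (2 * √(b - x)))) / √(b - x) ^ 2
      = (b - a) / (2 * (√(x - a) * √(b - x)) * (b - x)) := by
    rw [show b - a = √(b - x) ^ 2 + √(x - a) ^ 2 by rw [hs2, ht2]; ring]
    nth_rewrite 6 [← ht2]
    field_simp
    ring
  rw [hk, hu]
  have h1 : a - z ≠ 0 := by linarith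
  have h2 : x - z ≠ 0 := by linarith
  have h3 : b - a ≠ 0 := by linarith
  field_simp

theorem tendsto_arctan_mul_sqrt_div_sqrt_left {a b : ℝ} (k : ℝ) (hab : a < b) :
    Tendsto (fun y => Real.arctan (k * (√(y - a) / √(b - y)))) (nhdsWithin a (Set.Ioi a))
      (nhds 0) := by
  have hc : ContinuousAt (fun y => Real.arctan (k * (√(y - a) / √(b - y)))) a := by
    have : √(b - a) ≠ 0 := (Real.sqrt_pos.2 (sub_pos.2 hab)).ne'
    fun_prop (disch := assumption)
  simpa using hc.tendsto.mono_left nhdsWithin_le_nhds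

theorem tendsto_arctan_mul_sqrt_div_sqrt_right {a b k : ℝ} (hk : 0 < k) (hab : a < b) :
    Tendsto (fun y => Real.arctan (k * (√(y - a) / √(b - y)))) (nhdsWithin b (Set.Iio b))
      (nhds (Real.pi / 2)) := by
  refine (Real.tendsto_arctan_atTop.mono_right nhdsWithin_le_nhds).comp
    (Tendsto.const_mul_atTop hk ?_)
  have hs : Tendsto (fun y => √(y - a)) (nhdsWithin b (Set.Iio b)) (nhds √(b - a)) :=
    (Continuous.tendsto (by fun_prop) b).mono_left nhdsWithin_le_nhds
  have ht : Tendsto (fun y => √(b - y)) (nhdsWithin b (Set.Iio b))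
      (nhdsWithin 0 (Set.Ioi 0)) := by
    refine tendsto_nhdsWithin_iff.2 ⟨?_, ?_⟩
    · have : Tendsto (fun y => √(b - y)) (nhds b) (nhds √(b - b)) :=
        Continuous.tendsto (by fun_prop) b
      simpa using this.mono_left nhdsWithin_le_nhds
    · filter_upwards [self_mem_nhdsWithin] with y hy
      exact Real.sqrt_pos.2 (sub_pos.2 hy)
  simp only [div_eq_mul_inv]
  exact hs.pos_mul_atTop (Real.sqrt_pos.2 (sub_pos.2 hab)) ht.inv_tendsto_nhdsGT_zero

theorem integral_sqrt_div_mul_sq {a b c g : ℝ} (hc : 0 < c) (hca : c < a) (hab : a < b)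
    (habc : a * b = (a + b) * c) (hg : 0 < g) (hg2 : g ^ 2 = a * b) :
    ∫ x in a..b, √((b - x) * (x - a)) / (x * (x - c) ^ 2)
      = Real.pi / c ^ 2 * ((a + b) / 2 - g) := by
  have ha : 0 < a := hc.trans hca
  have hac : 0 < a - c := sub_pos.2 hca
  let F : ℝ → ℝ := fun y =>
    -(2 * g / c ^ 2) * Real.arctan (g / (a - 0) * (√(y - a) / √(b - y)))
      + (a + b) / c ^ 2 * Real.arctan (c / (a - c) * (√(y - a) / √(b - y)))
      - 1 / c * (√(y - a) * √(b - y) / (y - c))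
  have hF : ∀ x ∈ Set.Ioo a b,
      HasDerivAt F (√((b - x) * (x - a)) / (x * (x - c) ^ 2)) x := by
    rintro x ⟨hax, hxb⟩
    have hs0 : 0 < x - a := sub_pos.2 hax
    have ht0 : 0 < b - x := sub_pos.2 hxb
    have hs := Real.sqrt_pos.2 hs0
    have ht := Real.sqrt_pos.2 ht0
    have hs2 := Real.sq_sqrt hs0.le
    have ht2 := Real.sq_sqrt ht0.le
    have hx : x ≠ 0 := by linarith
    have hxc : x - c ≠ 0 := by linarith
    have ds : HasDerivAt (fun y => √(y - a)) (1 / (2 * √(x - a))) x :=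
      ((hasDerivAt_id x).sub_const a).sqrt hs0.ne'
    have dt : HasDerivAt (fun y => √(b - y)) (-1 / (2 * √(b - x))) x :=
      ((hasDerivAt_id x).const_sub b).sqrt ht0.ne'
    have d0 := hasDerivAt_arctan_mul_sqrt_div_sqrt (z := 0) ha (R := g) (by simpa using hg2) hax hxb
    have dc := hasDerivAt_arctan_mul_sqrt_div_sqrt hca (R := c) (by linarith) hax hxb
    have dw := (ds.mul dt).div ((hasDerivAt_id x).sub_const c) hxc
    refine (((d0.const_mul (-(2 * g / c ^ 2))).add (dc.const_mul ((a + b) / c ^ 2))).sub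
      (dw.const_mul (1 / c))).congr_deriv ?_
    rw [Real.sqrt_mul ht0.le]
    simp only [Pi.mul_apply, id]
    generalize √(x - a) = s at *
    generalize √(b - x) = t at *
    obtain rfl : a = x - s ^ 2 := by linarith
    obtain rfl : b = x + t ^ 2 := by linarith
    simp only [sub_zero]
    field_simp
    linear_combination (-2 * (x - c) ^ 2) * hg2 - 2 * x * (x - c) * habc
  have hint : IntervalIntegrable (fun x => √((b - x) * (x - a)) / (x * (x - c) ^ 2))
      volume a b := by
    refine ContinuousOn.intervalIntegrable fun x hx => ContinuousAt.continuousWithinAt ?_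
    rw [Set.uIcc_of_le hab.le] at hx
    have : x * (x - c) ^ 2 ≠ 0 :=
      mul_ne_zero (by linarith [hx.1]) (pow_ne_zero _ (by linarith [hx.1]))
    fun_prop (disch := assumption)
  have hw : ∀ e, c < e → ContinuousAt (fun y => √(y - a) * √(b - y) / (y - c)) e := by
    intro e he
    have : e - c ≠ 0 := by linarith
    fun_prop (disch := assumption)
  have hl : Tendsto F (nhdsWithin a (Set.Ioi a)) (nhds 0) := by
    have h := (((tendsto_arctan_mul_sqrt_div_sqrt_left (g / (a - 0)) hab).const_mul
      (-(2 * g / c ^ 2))).add ((tendsto_arctan_mul_sqrt_div_sqrt_left (c / (a - c)) hab).const_mul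
      ((a + b) / c ^ 2))).sub
      (((hw a hca).tendsto.mono_left nhdsWithin_le_nhds).const_mul (1 / c))
    simpa [F] using h
  have hr : Tendsto F (nhdsWithin b (Set.Iio b))
      (nhds (-(2 * g / c ^ 2) * (Real.pi / 2) + (a + b) / c ^ 2 * (Real.pi / 2))) := by
    have h := (((tendsto_arctan_mul_sqrt_div_sqrt_right (k := g / (a - 0))
      (by simpa using div_pos hg ha) hab).const_mul
      (-(2 * g / c ^ 2))).add ((tendsto_arctan_mul_sqrt_div_sqrt_right (div_pos hc hac)
      hab).const_mul ((a + b) / c ^ 2))).sub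
      (((hw b (hca.trans hab)).tendsto.mono_left nhdsWithin_le_nhds).const_mul (1 / c))
    simpa [F] using h
  rw [intervalIntegral.integral_eq_sub_of_hasDerivAt_of_tendsto hab hF hint hl hr]
  field_simp
  ring

/-- for positive integers `p < m`, with `d = p/m`, the value
`c = (m−p)²/(2(m+p)m)` lies in `(0, a_d)`, satisfies
`∫ (c/(x−c))² ϱ_d(x) dx = 1` (so it is the unique solution `c_p` when `n = p`),
and `c/a_d = (√m+√p)²/(2(m+p)) < 1`. -/
theorem stmt_1 (p m : ℕ) (hp : 0 < p) (hpm : p < m)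
    (c : ℝ) (hc : c = ((m : ℝ) - p) ^ 2 / (2 * ((m : ℝ) + p) * m)) :
    c ∈ Set.Ioo 0 (aMP ((p : ℝ) / m)) ∧
      (∫ x in (aMP ((p : ℝ) / m))..(bMP ((p : ℝ) / m)),
          (c / (x - c)) ^ 2 * rhoMP ((p : ℝ) / m) x) = 1 ∧
      c / aMP ((p : ℝ) / m) = (Real.sqrt m + Real.sqrt p) ^ 2 / (2 * ((m : ℝ) + p)) ∧
      c / aMP ((p : ℝ) / m) < 1 := by
  have hp' : (0 : ℝ) < p := by exact_mod_cast hp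
  have hpm' : (p : ℝ) < m := by exact_mod_cast hpm
  have hm' : (0 : ℝ) < m := hp'.trans hpm'
  have hsp := Real.sqrt_pos.2 hp'
  have hsm := Real.sqrt_pos.2 hm'
  have hsp2 := Real.sq_sqrt hp'.le
  have hsm2 := Real.sq_sqrt hm'.le
  have hlt : √(p : ℝ) < √(m : ℝ) := Real.sqrt_lt_sqrt hp'.le hpm'
  set d : ℝ := (p : ℝ) / m with hd
  have hd0 : 0 < d := div_pos hp' hm'
  have hd1 : d < 1 := (div_lt_one hm').2 hpm'
  have hr0 := Real.sqrt_pos.2 hd0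
  have hr1 : √d < 1 := by rw [Real.sqrt_lt' one_pos]; simpa using hd1
  have hr2 := Real.sq_sqrt hd0.le
  have hc0 : 0 < c := by
    have : 0 < (m : ℝ) - p := sub_pos.2 hpm'
    rw [hc]
    positivity
  have ha0 : 0 < aMP d := pow_pos (sub_pos.2 hr1) 2
  have hab : aMP d < bMP d := by unfold aMP bMP; nlinarith
  have hratio : c / aMP d = (√m + √p) ^ 2 / (2 * ((m : ℝ) + p)) := by
    have ha : aMP d = (√m - √p) ^ 2 / m := by
      unfold aMP
      rw [hd, Real.sqrt_div hp'.le]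
      nth_rewrite 3 [← hsm2]
      field_simp
    have : √(m : ℝ) - √p ≠ 0 := by linarith
    rw [ha, hc, show (m : ℝ) - p = (√m - √p) * (√m + √p) by linear_combination hsp2 - hsm2]
    field_simp
  have hlt1 : c / aMP d < 1 := by
    rw [hratio, div_lt_one (by positivity)]
    nlinarith [sq_pos_of_pos (sub_pos.2 hlt)]
  have hca : c < aMP d := (div_lt_one ha0).1 hlt1
  refine ⟨⟨hc0, hca⟩, ?_, hratio, hlt1⟩
  have hcd : 2 * (1 + d) * c = (1 - d) ^ 2 := by
    rw [hc, hd]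
    field_simp
  have hsum : aMP d + bMP d = 2 * (1 + d) := by
    unfold aMP bMP
    linear_combination 2 * hr2
  have hprod : (1 - d) ^ 2 = aMP d * bMP d := by
    unfold aMP bMP
    rw [← hr2, Real.sqrt_sq hr0.le]
    ring
  have key := integral_sqrt_div_mul_sq hc0 hca hab (by rw [hsum, ← hprod, hcd])
    (sub_pos.2 hd1) hprod
  have hcongr : ∫ x in aMP d..bMP d, (c / (x - c)) ^ 2 * rhoMP d x
      = ∫ x in aMP d..bMP d, c ^ 2 / (2 * Real.pi * d) *
        (√((bMP d - x) * (x - aMP d)) / (x * (x - c) ^ 2)) := by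
    refine intervalIntegral.integral_congr fun x hx => ?_
    rw [Set.uIcc_of_le hab.le] at hx
    have h1 : x ≠ 0 := by linarith [hx.1]
    have h2 : x - c ≠ 0 := by linarith [hx.1]
    have hxx : aMP d ≤ x ∧ x ≤ bMP d := hx
    simp only [rhoMP, if_pos hxx]
    field_simp
  rw [hcongr, intervalIntegral.integral_const_mul, key, hsum]
  field_simp
  ring
end

section
/- Let p < m and n be positive integers with m + n > p and n ≠ p. Then the unique c_p ∈ (0, a_{p/m}) satisfying ∫ (c/(x−c))² ϱ_{p/m}(x) dx = n/p is given explicitly by c_p = [ n(m+p)(m+n−p) − (m+2n−p)·√(mnp(m+n−p)) ] / [ m(n−p)(m+n) ]. -/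
open MeasureTheory Filter

/-- The argument of the arcsine in the primitive of `1 / ((x - z) √((b - x) (x - a)))`. -/
noncomputable def arcsinArg (a b z x : ℝ) : ℝ :=
  ((x - z) * (a + b - 2 * z) - 2 * ((a - z) * (b - z))) / ((b - a) * (x - z))

lemma arcsinArg_left {a b z : ℝ} (hab : a < b) (hz : z < a) : arcsinArg a b z a = -1 := by
  have h1 : b - a ≠ 0 := by linarith
  have h2 : a - z ≠ 0 := by linarith
  unfold arcsinArg
  field_simp
  ring

lemma arcsinArg_right {a b z : ℝ} (hab : a < b) (hz : z < a) : arcsinArg a b z b = 1 := by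
  have h1 : b - a ≠ 0 := by linarith
  have h2 : b - z ≠ 0 := by linarith
  unfold arcsinArg
  field_simp
  ring

lemma continuousOn_arcsinArg {a b z : ℝ} (hab : a < b) (hz : z < a) :
    ContinuousOn (arcsinArg a b z) (Set.Icc a b) := by
  unfold arcsinArg
  refine ContinuousOn.div (by fun_prop) (by fun_prop) fun x hx => ?_
  have h1 : 0 < b - a := by linarith
  have h2 : 0 < x - z := by linarith [hx.1]
  positivity

lemma hasDerivAt_arcsin_arcsinArg {a b z x : ℝ} (hz : z < a) (hax : a < x) (hxb : x < b) :
    HasDerivAt (fun y => Real.arcsin (arcsinArg a b z y))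
      (Real.sqrt ((a - z) * (b - z)) / ((x - z) * Real.sqrt ((b - x) * (x - a)))) x := by
  have hba : 0 < b - a := by linarith
  have hxz : 0 < x - z := by linarith
  have hR : 0 < (a - z) * (b - z) := mul_pos (by linarith) (by linarith)
  have hS : 0 < (b - x) * (x - a) := mul_pos (by linarith) (by linarith)
  set R := Real.sqrt ((a - z) * (b - z)) with hRdef
  set S := Real.sqrt ((b - x) * (x - a)) with hSdef
  have hR0 : 0 < R := Real.sqrt_pos.2 hR
  have hS0 : 0 < S := Real.sqrt_pos.2 hS
  have hR2 : R ^ 2 = (a - z) * (b - z) := Real.sq_sqrt hR.le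
  have hS2 : S ^ 2 = (b - x) * (x - a) := Real.sq_sqrt hS.le
  have hone : 1 - arcsinArg a b z x ^ 2 = (2 * R * S / ((b - a) * (x - z))) ^ 2 := by
    unfold arcsinArg
    rw [div_pow, div_pow, mul_pow, mul_pow _ S, mul_pow _ R, hR2, hS2]
    field_simp
    ring
  have hpos : 0 < 2 * R * S / ((b - a) * (x - z)) := by positivity
  have hsq : arcsinArg a b z x ^ 2 < 1 := by nlinarith [pow_pos hpos 2]
  have harg : HasDerivAt (arcsinArg a b z)
      (2 * R ^ 2 / ((b - a) * (x - z) ^ 2)) x := by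
    have hl : HasDerivAt (fun y : ℝ => y - z) 1 x := (hasDerivAt_id x).sub_const z
    have h := ((hl.mul_const (a + b - 2 * z)).sub_const (2 * ((a - z) * (b - z)))).div
      (hl.const_mul (b - a)) (by positivity)
    refine h.congr_deriv ?_
    rw [hR2]
    field_simp
    ring
  have h := (Real.hasDerivAt_arcsin (by nlinarith) (by nlinarith)).comp x harg
  refine h.congr_deriv ?_
  rw [hone, Real.sqrt_sq hpos.le]
  field_simp

lemma hasDerivAt_sqrt_mul_div_sub {a b c x : ℝ} (hc : c < a) (hax : a < x) (hxb : x < b) :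
    HasDerivAt (fun y => Real.sqrt ((b - y) * (y - a)) / (y - c))
      (((a - c) * (b - c) / (x - c) ^ 2 - (a + b - 2 * c) / (2 * (x - c)))
        / Real.sqrt ((b - x) * (x - a))) x := by
  have hxc : 0 < x - c := by linarith
  have hS : 0 < (b - x) * (x - a) := mul_pos (by linarith) (by linarith)
  have hS0 := Real.sqrt_pos.2 hS
  have hS2 := Real.sq_sqrt hS.le
  have hq : HasDerivAt (fun y : ℝ => (b - y) * (y - a)) ((-1) * (x - a) + (b - x) * 1) x :=
    ((hasDerivAt_id x).const_sub b).mul ((hasDerivAt_id x).sub_const a)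
  have h := (hq.sqrt hS.ne').div ((hasDerivAt_id x).sub_const c) hxc.ne'
  refine h.congr_deriv ?_
  simp only [id]
  set S := Real.sqrt ((b - x) * (x - a))
  field_simp
  rw [hS2]
  ring

lemma integral_sqrt_div_mul_sub_sq {a b c : ℝ} (hc : 0 < c) (hca : c < a) (hab : a < b) :
    ∫ x in a..b, Real.sqrt ((b - x) * (x - a)) / (x * (x - c) ^ 2) =
      Real.pi * (-Real.sqrt (a * b) / c ^ 2
        + (a * b / c ^ 2 - (a + b) / (2 * c)) / Real.sqrt ((a - c) * (b - c))) := by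
  have ha : 0 < a := hc.trans hca
  have hR : 0 < (a - c) * (b - c) := mul_pos (by linarith) (by linarith)
  have hP : 0 < a * b := mul_pos ha (by linarith)
  have hR0 := Real.sqrt_pos.2 hR
  have hP0 := Real.sqrt_pos.2 hP
  have hP2 := Real.sq_sqrt hP.le
  rw [intervalIntegral.integral_eq_sub_of_hasDerivAt_of_le hab.le
    (f := fun x => -Real.sqrt (a * b) / c ^ 2 * Real.arcsin (arcsinArg a b 0 x)
      + (a * b / c ^ 2 - (a + b) / (2 * c)) / Real.sqrt ((a - c) * (b - c))
        * Real.arcsin (arcsinArg a b c x)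
      - 1 / c * (Real.sqrt ((b - x) * (x - a)) / (x - c)))]
  · simp only [arcsinArg_left hab ha, arcsinArg_right hab ha, arcsinArg_left hab hca,
      arcsinArg_right hab hca, Real.arcsin_one, Real.arcsin_neg_one, sub_self, zero_mul, mul_zero,
      Real.sqrt_zero, zero_div]
    ring
  · have h0 := Real.continuous_arcsin.comp_continuousOn (continuousOn_arcsinArg hab ha)
    have h1 := Real.continuous_arcsin.comp_continuousOn (continuousOn_arcsinArg hab hca)
    have h2 : ContinuousOn (fun x => Real.sqrt ((b - x) * (x - a)) / (x - c)) (Set.Icc a b) :=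
      ContinuousOn.div (by fun_prop) (by fun_prop) fun x hx => by linarith [hx.1]
    exact ((h0.const_mul _).add (h1.const_mul _)).sub (h2.const_mul _)
  · rintro x ⟨hax, hxb⟩
    have h := (((hasDerivAt_arcsin_arcsinArg ha hax hxb).const_mul
      (-Real.sqrt (a * b) / c ^ 2)).add
      ((hasDerivAt_arcsin_arcsinArg hca hax hxb).const_mul
      ((a * b / c ^ 2 - (a + b) / (2 * c)) / Real.sqrt ((a - c) * (b - c))))).sub
      ((hasDerivAt_sqrt_mul_div_sub hca hax hxb).const_mul (1 / c))
    refine h.congr_deriv ?_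
    have hS : 0 < (b - x) * (x - a) := mul_pos (by linarith) (by linarith)
    have hS0 := Real.sqrt_pos.2 hS
    have hS2 := Real.sq_sqrt hS.le
    have hx : 0 < x := ha.trans hax
    have hxc : 0 < x - c := by linarith
    simp only [sub_zero]
    set S := Real.sqrt ((b - x) * (x - a))
    set P := Real.sqrt (a * b)
    set R := Real.sqrt ((a - c) * (b - c))
    field_simp
    rw [hS2, hP2]
    ring
  · refine ContinuousOn.intervalIntegrable ?_
    rw [Set.uIcc_of_le hab.le]
    refine ContinuousOn.div (by fun_prop) (by fun_prop) fun x hx => ?_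
    have h1 : 0 < x := ha.trans_le hx.1
    have h2 : 0 < x - c := by linarith [hx.1]
    positivity

lemma aMP_add_bMP {d : ℝ} (hd : 0 ≤ d) : aMP d + bMP d = 2 * (1 + d) := by
  unfold aMP bMP
  linear_combination 2 * Real.sq_sqrt hd

lemma aMP_mul_bMP {d : ℝ} (hd : 0 ≤ d) : aMP d * bMP d = (1 - d) ^ 2 := by
  have h : (1 - Real.sqrt d) * (1 + Real.sqrt d) = 1 - d := by
    linear_combination -Real.sq_sqrt hd
  rw [aMP, bMP, ← mul_pow, h]

lemma aMP_sub_mul_bMP_sub {d : ℝ} (hd : 0 ≤ d) (c : ℝ) :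
    (aMP d - c) * (bMP d - c) = (1 - d) ^ 2 - 2 * (1 + d) * c + c ^ 2 := by
  linear_combination aMP_mul_bMP hd - c * aMP_add_bMP hd

lemma integral_div_sub_sq_mul_rhoMP {d c : ℝ} (hd : 0 < d) (hd1 : d < 1) (hc : 0 < c)
    (hca : c < aMP d) :
    ∫ x in (aMP d)..(bMP d), (c / (x - c)) ^ 2 * rhoMP d x =
      (((1 - d) ^ 2 - (1 + d) * c) / Real.sqrt ((1 - d) ^ 2 - 2 * (1 + d) * c + c ^ 2)
        - (1 - d)) / (2 * d) := by
  have hab := aMP_lt_bMP hd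
  have hR := aMP_sub_mul_bMP_sub hd.le c
  have hcongr : Set.EqOn (fun x => (c / (x - c)) ^ 2 * rhoMP d x)
      (fun x => c ^ 2 / (2 * Real.pi * d)
        * (Real.sqrt ((bMP d - x) * (x - aMP d)) / (x * (x - c) ^ 2)))
      (Set.uIcc (aMP d) (bMP d)) := by
    intro x hx
    rw [Set.uIcc_of_le hab.le] at hx
    simp only [rhoMP, if_pos (show aMP d ≤ x ∧ x ≤ bMP d from hx)]
    have h1 : 0 < x - c := by linarith [hx.1]
    have h2 : 0 < x := by linarith
    have := Real.pi_pos
    field_simp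
  rw [intervalIntegral.integral_congr hcongr, intervalIntegral.integral_const_mul,
    integral_sqrt_div_mul_sub_sq hc hca hab, aMP_mul_bMP hd.le, hR, aMP_add_bMP hd.le,
    Real.sqrt_sq (by linarith : (0 : ℝ) ≤ 1 - d)]
  have hR0 : 0 < Real.sqrt ((1 - d) ^ 2 - 2 * (1 + d) * c + c ^ 2) := by
    rw [← hR]
    exact Real.sqrt_pos.2 (mul_pos (by linarith) (by linarith))
  have := Real.pi_pos
  field_simp
  ring

/-- for positive integers `p < m`, `n` with `m + n > p` and `n ≠ p`,
the unique `c_p ∈ (0, a_{p/m})` with `∫ (c/(x−c))² ϱ_{p/m}(x) dx = n/p` is given by the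
explicit formula
`c_p = (n(m+p)(m+n−p) − (m+2n−p)√(mnp(m+n−p))) / (m(n−p)(m+n))`. -/
theorem stmt_2 (p m n : ℕ) (hp : 0 < p) (hn : 0 < n) (hpm : p < m) (hmn : p < m + n)
    (hnp : n ≠ p) (c : ℝ) (hc1 : c ∈ Set.Ioo 0 (aMP ((p : ℝ) / m)))
    (hc2 : (∫ x in (aMP ((p : ℝ) / m))..(bMP ((p : ℝ) / m)),
        (c / (x - c)) ^ 2 * rhoMP ((p : ℝ) / m) x) = (n : ℝ) / p) :
    c = ((n : ℝ) * ((m : ℝ) + p) * ((m : ℝ) + n - p)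
          - ((m : ℝ) + 2 * n - p) * Real.sqrt ((m : ℝ) * n * p * ((m : ℝ) + n - p)))
        / ((m : ℝ) * ((n : ℝ) - p) * ((m : ℝ) + n)) := by
  obtain ⟨hc, hca⟩ := hc1
  have hp' : (0 : ℝ) < p := by exact_mod_cast hp
  have hn' : (0 : ℝ) < n := by exact_mod_cast hn
  have hpm' : (p : ℝ) < m := by exact_mod_cast hpm
  have hnp' : (n : ℝ) - p ≠ 0 := sub_ne_zero.2 (by exact_mod_cast hnp)
  have hm' : (0 : ℝ) < m := hp'.trans hpm'
  have hq : (0 : ℝ) < (m : ℝ) + n - p := by linarith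
  have hd : (0 : ℝ) < (p : ℝ) / m := by positivity
  have hd1 : (p : ℝ) / m < 1 := (div_lt_one hm').2 hpm'
  have hc_lt : c < 1 := by
    have h0 := Real.sqrt_pos.2 hd
    have h1 : Real.sqrt ((p : ℝ) / m) < 1 := (Real.sqrt_lt' one_pos).2 (by simpa using hd1)
    unfold aMP at hca
    nlinarith
  have hRpos : 0 < (1 - (p : ℝ) / m) ^ 2 - 2 * (1 + (p : ℝ) / m) * c + c ^ 2 := by
    rw [← aMP_sub_mul_bMP_sub hd.le]
    exact mul_pos (sub_pos.2 hca) (sub_pos.2 (hca.trans (aMP_lt_bMP hd)))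
  rw [integral_div_sub_sq_mul_rhoMP hd hd1 hc hca] at hc2
  have hR0 := Real.sqrt_pos.2 hRpos
  have hR2 := Real.sq_sqrt hRpos.le
  set R := Real.sqrt ((1 - (p : ℝ) / m) ^ 2 - 2 * (1 + (p : ℝ) / m) * c + c ^ 2)
  have hT : (0 : ℝ) < (m : ℝ) * n * p * ((m : ℝ) + n - p) := by positivity
  have hT0 := Real.sqrt_pos.2 hT
  have hT2 := Real.sq_sqrt hT.le
  set T := Real.sqrt ((m : ℝ) * n * p * ((m : ℝ) + n - p))
  have hlin : ((m : ℝ) - p) ^ 2 - (m + p) * m * c = (m + 2 * n - p) * (m * R) := by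
    field_simp at hc2
    linarith
  have hR2' : ((m : ℝ) * R) ^ 2 = (m - p) ^ 2 - 2 * (m + p) * m * c + m ^ 2 * c ^ 2 := by
    rw [mul_pow, hR2]
    field_simp
  have hquad : ((m : ℝ) * (n - p) * (m + n)) * c ^ 2 * m
      - 2 * (n * (m + p) * (m + n - p)) * c * m + n * (m - p) ^ 2 * (m + n - p) = 0 := by
    have h := congrArg (· ^ 2) hlin
    simp only [mul_pow _ ((m : ℝ) * R), hR2'] at h
    have h4 : (4 : ℝ) * (((m : ℝ) * (n - p) * (m + n)) * c ^ 2 * m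
      - 2 * (n * (m + p) * (m + n - p)) * c * m + n * (m - p) ^ 2 * (m + n - p)) = 0 := by
      linear_combination -h
    linarith
  have hsq : ((m : ℝ) * (n - p) * (m + n) * c - n * (m + p) * (m + n - p)) ^ 2
      = ((m + 2 * n - p) * T) ^ 2 := by
    rw [mul_pow _ T, hT2]
    linear_combination ((n : ℝ) - p) * (m + n) * hquad
  have hKT : 0 < ((m : ℝ) + 2 * n - p) * T := mul_pos (by linarith) hT0
  have hX : 0 < (n : ℝ) * (m + p) * (m + n - p) := by positivity
  rw [eq_div_iff (by positivity)]
  rcases sq_eq_sq_iff_eq_or_eq_neg.1 hsq with h | h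
  · exfalso
    rcases lt_or_gt_of_ne hnp' with hneg | hpos
    · have : 0 < (m : ℝ) * (m + n) * c * (-((n : ℝ) - p)) := by
        have := neg_pos.2 hneg
        positivity
      nlinarith
    · have h1 : 0 < (m : ℝ) * (n - p) * (m + n) * (1 - c) := by
        have : 0 < 1 - c := by linarith
        positivity
      have h2 : (n : ℝ) * (m + p) * (m + n - p) - m * (n - p) * (m + n)
          = p * (n * (m + n - p)) + m ^ 2 * p := by ring
      have h3 : 0 < (p : ℝ) * (n * (m + n - p)) + m ^ 2 * p := by positivity
      linarith
  · linarith
end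

section
/- Let p < m and n be positive integers with m + n > p, and let α_p, β_p ∈ (0, π/2) satisfy sin²(α_p) = p/(m+n) and sin²(β_p) = n/(m+n). Define μ_p = (1/c_p)·(1 + (p/n)∫ c_p/(x−c_p) ϱ_{p/m}(x) dx). Then (1/c_p³)·(1 + (p/n)∫ (c_p/(x−c_p))³ ϱ_{p/m}(x) dx) = μ_p³ · (16 n²/(m+n)²) · 1/( sin(2β_p)·sin(2α_p)·sin²(2α_p + 2β_p) ). -/
open MeasureTheory Filter

/-- The denominator `1 - 2 t cos θ + t²` of the Poisson kernel. -/
noncomputable def poissonDenom (t θ : ℝ) : ℝ := 1 - 2 * t * Real.cos θ + t ^ 2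

theorem poissonDenom_pos {t : ℝ} (h0 : 0 ≤ t) (h1 : t < 1) (θ : ℝ) : 0 < poissonDenom t θ := by
  have : t * Real.cos θ ≤ t := mul_le_of_le_one_right h0 (Real.cos_le_one θ)
  unfold poissonDenom
  nlinarith [sq_pos_of_pos (sub_pos.2 h1)]

theorem hasDerivAt_poissonDenom (t θ : ℝ) :
    HasDerivAt (poissonDenom t) (2 * t * Real.sin θ) θ := by
  have h := (((Real.hasDerivAt_cos θ).const_mul (2 * t)).const_sub 1).add_const (t ^ 2)
  exact h.congr_deriv (by ring)

theorem continuous_poissonDenom (t : ℝ) : Continuous (poissonDenom t) := by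
  unfold poissonDenom
  fun_prop

/-- The integral of `sin² θ / (1 - 2 t cos θ + t²)^k` over `[0, π]`. -/
noncomputable def sinSqPoisson (t : ℝ) (k : ℕ) : ℝ :=
  ∫ θ in (0 : ℝ)..Real.pi, Real.sin θ ^ 2 / poissonDenom t θ ^ k

theorem intervalIntegrable_sinSqPoisson {t : ℝ} (h0 : 0 ≤ t) (h1 : t < 1) (k : ℕ) :
    IntervalIntegrable (fun θ => Real.sin θ ^ 2 / poissonDenom t θ ^ k) volume 0 Real.pi :=
  ((Real.continuous_sin.pow 2).div ((continuous_poissonDenom t).pow k)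
    fun θ => pow_ne_zero k (poissonDenom_pos h0 h1 θ).ne').intervalIntegrable _ _

theorem sinSqPoisson_zero (t : ℝ) : sinSqPoisson t 0 = Real.pi / 2 := by
  simp [sinSqPoisson, integral_sin_sq]

theorem hasDerivAt_arctan_poisson {t : ℝ} (h0 : 0 ≤ t) (h1 : t < 1) (θ : ℝ) :
    HasDerivAt (fun θ => Real.arctan (t * Real.sin θ / (1 - t * Real.cos θ)))
      (t * (Real.cos θ - t) / poissonDenom t θ) θ := by
  have hD := poissonDenom_pos h0 h1 θ
  have hE : 0 < 1 - t * Real.cos θ := by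
    nlinarith [mul_le_of_le_one_right h0 (Real.cos_le_one θ)]
  have hsc := Real.sin_sq_add_cos_sq θ
  have hDE : poissonDenom t θ = (1 - t * Real.cos θ) ^ 2 + (t * Real.sin θ) ^ 2 := by
    unfold poissonDenom
    linear_combination (-t ^ 2) * hsc
  have hA := (((Real.hasDerivAt_sin θ).const_mul t).div
    (((Real.hasDerivAt_cos θ).const_mul t).const_sub 1) hE.ne').arctan
  refine hA.congr_deriv ?_
  rw [hDE] at hD ⊢
  have hsum : 1 + (t * Real.sin θ / (1 - t * Real.cos θ)) ^ 2
      = ((1 - t * Real.cos θ) ^ 2 + (t * Real.sin θ) ^ 2) / (1 - t * Real.cos θ) ^ 2 := by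
    field_simp
  simp only [Pi.div_apply]
  rw [hsum]
  field_simp
  linear_combination (-t ^ 2) * hsc

theorem sinSqPoisson_one {t : ℝ} (h0 : 0 < t) (h1 : t < 1) :
    sinSqPoisson t 1 = Real.pi / 2 := by
  have hF : ∀ θ ∈ Set.uIcc 0 Real.pi,
      HasDerivAt (fun θ => (2 * t ^ 2 * θ + 2 * t * Real.sin θ - 2 * (1 - t ^ 2) *
        Real.arctan (t * Real.sin θ / (1 - t * Real.cos θ))) / (4 * t ^ 2))
        (Real.sin θ ^ 2 / poissonDenom t θ ^ 1) θ := by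
    intro θ _
    have hD := (poissonDenom_pos h0.le h1 θ).ne'
    have h := ((((hasDerivAt_id θ).const_mul (2 * t ^ 2)).add
      ((Real.hasDerivAt_sin θ).const_mul (2 * t))).sub
      ((hasDerivAt_arctan_poisson h0.le h1 θ).const_mul (2 * (1 - t ^ 2)))).div_const (4 * t ^ 2)
    refine h.congr_deriv ?_
    rw [Real.sin_sq]
    field_simp
    unfold poissonDenom
    ring
  rw [sinSqPoisson, intervalIntegral.integral_eq_sub_of_hasDerivAt hF
    (intervalIntegrable_sinSqPoisson h0.le h1 1)]
  simp
  field_simp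
  ring

/-- Integrating the derivative of `sin³ θ / (1 - 2 t cos θ + t²)^(k + 1)` over `[0, π]`. -/
theorem sinSqPoisson_recurrence {t : ℝ} (h0 : 0 < t) (h1 : t < 1) (k : ℕ) :
    3 * ((1 + t ^ 2) * sinSqPoisson t (k + 1) - sinSqPoisson t k) =
      (k + 1) * (-(1 - t ^ 2) ^ 2 * sinSqPoisson t (k + 2)
        + 2 * (1 + t ^ 2) * sinSqPoisson t (k + 1) - sinSqPoisson t k) := by
  have hI := intervalIntegrable_sinSqPoisson h0.le h1
  set f : ℕ → ℝ → ℝ := fun j θ => Real.sin θ ^ 2 / poissonDenom t θ ^ j with hf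
  have hF : ∀ θ ∈ Set.uIcc 0 Real.pi,
      HasDerivAt (fun θ => Real.sin θ ^ 3 / poissonDenom t θ ^ (k + 1))
        (((3 * (1 + t ^ 2) - (k + 1) * (2 * (1 + t ^ 2))) / (2 * t)) * f (k + 1) θ
          + (((k + 1) - 3) / (2 * t)) * f k θ
          + ((k + 1) * (1 - t ^ 2) ^ 2 / (2 * t)) * f (k + 2) θ) θ := by
    intro θ _
    have hD := (poissonDenom_pos h0.le h1 θ).ne'
    have h := ((Real.hasDerivAt_sin θ).pow 3).div
      ((hasDerivAt_poissonDenom t θ).pow (k + 1)) (pow_ne_zero _ hD)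
    refine h.congr_deriv ?_
    have hc : Real.cos θ = (1 + t ^ 2 - poissonDenom t θ) / (2 * t) := by
      unfold poissonDenom
      field_simp
      ring
    have hs : Real.sin θ ^ 2 = 1 - ((1 + t ^ 2 - poissonDenom t θ) / (2 * t)) ^ 2 := by
      rw [← hc, Real.sin_sq]
    simp only [hf, Pi.pow_apply]
    rw [hc]
    clear hc h hI hf
    generalize poissonDenom t θ = D at *
    generalize Real.sin θ = s at *
    push_cast
    have hs' : 4 * t ^ 2 * s ^ 2 = 4 * t ^ 2 - (1 + t ^ 2 - D) ^ 2 := by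
      rw [hs]
      field_simp
      ring
    field_simp
    simp only [pow_succ]
    field_simp
    linear_combination (-(k + 1) * s ^ 2) * hs'
  have h := intervalIntegral.integral_eq_sub_of_hasDerivAt hF
    ((((hI (k + 1)).const_mul _).add ((hI k).const_mul _)).add ((hI (k + 2)).const_mul _))
  rw [intervalIntegral.integral_add (((hI (k + 1)).const_mul _).add ((hI k).const_mul _))
    ((hI (k + 2)).const_mul _), intervalIntegral.integral_add ((hI (k + 1)).const_mul _)
    ((hI k).const_mul _)] at h
  simp only [intervalIntegral.integral_const_mul, Real.sin_pi, Real.sin_zero] at h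
  change _ * sinSqPoisson t (k + 1) + _ * sinSqPoisson t k + _ * sinSqPoisson t (k + 2) = _ at h
  field_simp at h
  simp at h
  linear_combination h

theorem sinSqPoisson_two {t : ℝ} (h0 : 0 < t) (h1 : t < 1) :
    sinSqPoisson t 2 = Real.pi / (2 * (1 - t ^ 2)) := by
  have h := sinSqPoisson_recurrence h0 h1 0
  have ht : 1 - t ^ 2 ≠ 0 := by nlinarith
  simp only [zero_add, sinSqPoisson_zero, sinSqPoisson_one h0 h1, Nat.cast_zero] at h
  rw [eq_div_iff (mul_ne_zero two_ne_zero ht)]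
  refine mul_left_cancel₀ ht ?_
  linear_combination 2 * h

theorem sinSqPoisson_three {t : ℝ} (h0 : 0 < t) (h1 : t < 1) :
    sinSqPoisson t 3 = Real.pi / (2 * (1 - t ^ 2) ^ 3) := by
  have h := sinSqPoisson_recurrence h0 h1 1
  have ht : 1 - t ^ 2 ≠ 0 := by nlinarith
  simp only [Nat.reduceAdd, sinSqPoisson_one h0 h1, sinSqPoisson_two h0 h1, Nat.cast_one] at h
  refine mul_left_cancel₀ (pow_ne_zero 2 ht) ?_
  field_simp at h ⊢
  linear_combination h / 2

/-- The substitution `x = 1 - 2 r cos θ + r²` turns integrals against the Marchenko–Pastur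
density of ratio `r²` into integrals over `[0, π]`. -/
theorem integral_mul_rhoMP {r : ℝ} (h0 : 0 < r) (h1 : r < 1) {g : ℝ → ℝ}
    (hg : ContinuousOn g (Set.Icc (aMP (r ^ 2)) (bMP (r ^ 2)))) :
    ∫ x in (aMP (r ^ 2))..(bMP (r ^ 2)), g x * rhoMP (r ^ 2) x =
      (2 / Real.pi) * ∫ θ in (0 : ℝ)..Real.pi,
        g (poissonDenom r θ) * (Real.sin θ ^ 2 / poissonDenom r θ) := by
  have ha : aMP (r ^ 2) = (1 - r) ^ 2 := by rw [aMP, Real.sqrt_sq h0.le]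
  have hb : bMP (r ^ 2) = (1 + r) ^ 2 := by rw [bMP, Real.sqrt_sq h0.le]
  have hab : aMP (r ^ 2) ≤ bMP (r ^ 2) := by
    rw [ha, hb]
    nlinarith
  have hmem : ∀ θ, poissonDenom r θ ∈ Set.Icc (aMP (r ^ 2)) (bMP (r ^ 2)) := by
    intro θ
    rw [ha, hb, poissonDenom]
    constructor <;> nlinarith [Real.cos_le_one θ, Real.neg_one_le_cos θ]
  have hcong : ∫ x in (aMP (r ^ 2))..(bMP (r ^ 2)), g x * rhoMP (r ^ 2) x =
      ∫ x in (poissonDenom r 0)..(poissonDenom r Real.pi),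
        g x * ((1 / (2 * Real.pi * r ^ 2 * x)) *
          Real.sqrt ((bMP (r ^ 2) - x) * (x - aMP (r ^ 2)))) := by
    have e0 : poissonDenom r 0 = aMP (r ^ 2) := by
      rw [ha, poissonDenom, Real.cos_zero]
      ring
    have e1 : poissonDenom r Real.pi = bMP (r ^ 2) := by
      rw [hb, poissonDenom, Real.cos_pi]
      ring
    rw [e0, e1]
    refine intervalIntegral.integral_congr fun x hx => ?_
    rw [Set.uIcc_of_le hab] at hx
    simp only [rhoMP]
    rw [if_pos ⟨hx.1, hx.2⟩]
  have hcont : ContinuousOn (fun x => g x * ((1 / (2 * Real.pi * r ^ 2 * x)) *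
      Real.sqrt ((bMP (r ^ 2) - x) * (x - aMP (r ^ 2)))))
      (poissonDenom r '' Set.uIcc 0 Real.pi) := by
    refine (hg.mono ?_).mul (ContinuousOn.mul ?_ (Continuous.continuousOn (by fun_prop)))
    · rintro _ ⟨θ, -, rfl⟩
      exact hmem θ
    · refine continuousOn_const.div (Continuous.continuousOn (by fun_prop)) ?_
      rintro _ ⟨θ, -, rfl⟩
      have hD := poissonDenom_pos h0.le h1 θ
      positivity
  rw [hcong, ← intervalIntegral.integral_comp_mul_deriv'' (f' := fun θ => 2 * r * Real.sin θ)
    (continuous_poissonDenom r).continuousOn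
    (fun θ _ => (hasDerivAt_poissonDenom r θ).hasDerivWithinAt)
    (Continuous.continuousOn (by fun_prop)) hcont, ← intervalIntegral.integral_const_mul]
  refine intervalIntegral.integral_congr fun θ hθ => ?_
  rw [Set.uIcc_of_le Real.pi_pos.le] at hθ
  have hs := Real.sin_nonneg_of_mem_Icc hθ
  have hsq : (bMP (r ^ 2) - poissonDenom r θ) * (poissonDenom r θ - aMP (r ^ 2))
      = (2 * r * Real.sin θ) ^ 2 := by
    rw [ha, hb, poissonDenom]
    linear_combination (-4 * r ^ 2) * Real.sin_sq_add_cos_sq θ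
  have hD := (poissonDenom_pos h0.le h1 θ).ne'
  simp only [Function.comp_apply]
  rw [hsq, Real.sqrt_sq (by positivity)]
  field_simp

theorem integral_rhoMP {r : ℝ} (h0 : 0 < r) (h1 : r < 1) :
    ∫ x in (aMP (r ^ 2))..(bMP (r ^ 2)), rhoMP (r ^ 2) x = 1 := by
  have h := integral_mul_rhoMP h0 h1 (g := fun _ => 1) continuousOn_const
  have h' := sinSqPoisson_one h0 h1
  simp only [sinSqPoisson, pow_one] at h'
  simp only [one_mul, h'] at h
  rw [h]
  field_simp

/-- A recurrence for the moments of `c / (x - c)` under the Marchenko–Pastur law of ratio `r²`,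
where `c = (1 - r t) (1 - r / t)`. -/
theorem integral_pow_succ_mul_rhoMP {r t c : ℝ} (h0 : 0 < r) (hrt : r < t) (h1 : t < 1)
    (hc : c = (1 - r * t) * (1 - r / t)) (k : ℕ) :
    ∫ x in (aMP (r ^ 2))..(bMP (r ^ 2)), (c / (x - c)) ^ (k + 1) * rhoMP (r ^ 2) x =
      (2 / Real.pi) * (c ^ k * (t / r) ^ (k + 1) * sinSqPoisson t (k + 1))
      - ∫ x in (aMP (r ^ 2))..(bMP (r ^ 2)), (c / (x - c)) ^ k * rhoMP (r ^ 2) x := by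
  have ht0 : 0 < t := h0.trans hrt
  have hxc : ∀ θ, poissonDenom r θ - c = r / t * poissonDenom t θ := by
    intro θ
    rw [hc]
    unfold poissonDenom
    field_simp
    ring
  have hca : c < aMP (r ^ 2) := by
    have h := hxc 0
    have h2 := poissonDenom_pos ht0.le h1 0
    have h3 : 0 < r / t * poissonDenom t 0 := by positivity
    have h4 : poissonDenom r 0 = aMP (r ^ 2) := by
      rw [aMP, Real.sqrt_sq h0.le, poissonDenom, Real.cos_zero]
      ring
    linarith
  have hg : ∀ j : ℕ, ContinuousOn (fun x => (c / (x - c)) ^ j)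
      (Set.Icc (aMP (r ^ 2)) (bMP (r ^ 2))) := fun j =>
    (continuousOn_const.div (continuousOn_id.sub continuousOn_const)
      fun x hx => (sub_pos.2 (hca.trans_le hx.1)).ne').pow j
  have hr1 := hrt.trans h1
  have hDr : ∀ θ, poissonDenom r θ ≠ 0 := fun θ => (poissonDenom_pos h0.le hr1 θ).ne'
  have hDt : ∀ θ, poissonDenom t θ ≠ 0 := fun θ => (poissonDenom_pos ht0.le h1 θ).ne'
  rw [integral_mul_rhoMP h0 hr1 (hg (k + 1)), integral_mul_rhoMP h0 hr1 (hg k), sinSqPoisson]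
  have hint : IntervalIntegrable (fun θ => (c / (poissonDenom r θ - c)) ^ k *
      (Real.sin θ ^ 2 / poissonDenom r θ)) volume 0 Real.pi := by
    refine Continuous.intervalIntegrable ?_ _ _
    have hcr := continuous_poissonDenom r
    refine ((continuous_const.div (hcr.sub continuous_const) fun θ => ?_).pow k).mul
      ((Real.continuous_sin.pow 2).div hcr hDr)
    simp only [Pi.sub_apply, hxc]
    exact mul_ne_zero (by positivity) (hDt θ)
  rw [← mul_sub, ← intervalIntegral.integral_const_mul (c ^ k * (t / r) ^ (k + 1)),
    ← intervalIntegral.integral_sub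
      ((intervalIntegrable_sinSqPoisson ht0.le h1 (k + 1)).const_mul _) hint]
  congr 1
  refine intervalIntegral.integral_congr fun θ _ => ?_
  have key : c * (t / r) = (t / r) * poissonDenom r θ - poissonDenom t θ := by
    rw [show poissonDenom r θ = c + r / t * poissonDenom t θ by linear_combination hxc θ]
    field_simp
    ring
  have hcD : c / (r / t * poissonDenom t θ) = c * (t / r) / poissonDenom t θ := by
    field_simp
  have hpow : c ^ k * (t / r) ^ (k + 1) = (t / r) * (c * (t / r)) ^ k := by ring
  have hDr' := hDr θ
  have hDt' := hDt θ
  rw [hxc, hcD, hpow, pow_succ]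
  nth_rewrite 2 [key]
  rw [div_pow, sub_div, pow_succ]
  field_simp
  ring

theorem exists_parameter {r c : ℝ} (h0 : 0 < r) (h1 : r < 1)
    (hc : c ∈ Set.Ioo 0 (aMP (r ^ 2))) :
    ∃ t, r < t ∧ t < 1 ∧ c = (1 - r * t) * (1 - r / t) := by
  have hcont : ContinuousOn (fun t => (1 - r * t) * (1 - r / t)) (Set.Icc r 1) := by
    refine ContinuousOn.mul (by fun_prop) (continuousOn_const.sub
      (continuousOn_const.div continuousOn_id fun x hx => (h0.trans_le hx.1).ne'))
  have h := intermediate_value_Ioo h1.le hcont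
  have hmem : c ∈ Set.Ioo ((1 - r * r) * (1 - r / r)) ((1 - r * 1) * (1 - r / 1)) := by
    rw [aMP, Real.sqrt_sq h0.le] at hc
    rw [div_self h0.ne']
    constructor
    · linarith [hc.1]
    · linarith [hc.2]
  obtain ⟨t, ht, rfl⟩ := h hmem
  exact ⟨t, ht.1, ht.2, rfl⟩

/-- for positive integers `p < m`, `n` with `m + n > p`, with `α_p, β_p ∈ (0,π/2)`
as in the text and `μ_p` defined from the unique `c_p`, one has
`(1/c_p³)(1 + (p/n)∫ (c_p/(x−c_p))³ ϱ_{p/m}(x) dx)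
  = μ_p³ · (16n²/(m+n)²) / (sin(2β_p)sin(2α_p)sin²(2α_p+2β_p))`. -/
theorem stmt_4 (p m n : ℕ) (hp : 0 < p) (hn : 0 < n) (hpm : p < m) (hmn : p < m + n)
    (c : ℝ) (hc1 : c ∈ Set.Ioo 0 (aMP ((p : ℝ) / m)))
    (hc2 : (∫ x in (aMP ((p : ℝ) / m))..(bMP ((p : ℝ) / m)),
        (c / (x - c)) ^ 2 * rhoMP ((p : ℝ) / m) x) = (n : ℝ) / p)
    (α β : ℝ) (hα : α ∈ Set.Ioo 0 (Real.pi / 2)) (hβ : β ∈ Set.Ioo 0 (Real.pi / 2))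
    (hsinα : Real.sin α ^ 2 = (p : ℝ) / ((m : ℝ) + n))
    (hsinβ : Real.sin β ^ 2 = (n : ℝ) / ((m : ℝ) + n))
    (μ : ℝ)
    (hμ : μ = (1 / c) * (1 + ((p : ℝ) / n) *
        ∫ x in (aMP ((p : ℝ) / m))..(bMP ((p : ℝ) / m)),
          (c / (x - c)) * rhoMP ((p : ℝ) / m) x)) :
    (1 / c ^ 3) * (1 + ((p : ℝ) / n) *
        ∫ x in (aMP ((p : ℝ) / m))..(bMP ((p : ℝ) / m)),
          (c / (x - c)) ^ 3 * rhoMP ((p : ℝ) / m) x)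
      = μ ^ 3 * (16 * (n : ℝ) ^ 2 / ((m : ℝ) + n) ^ 2) *
          (1 / (Real.sin (2 * β) * Real.sin (2 * α) * Real.sin (2 * α + 2 * β) ^ 2)) := by
  have hpR : (0 : ℝ) < p := by exact_mod_cast hp
  have hnR : (0 : ℝ) < n := by exact_mod_cast hn
  have hpmR : (p : ℝ) < m := by exact_mod_cast hpm
  have hmR : (0 : ℝ) < m := hpR.trans hpmR
  have hsa : 0 < Real.sin α := Real.sin_pos_of_pos_of_lt_pi hα.1 (by linarith [hα.2, Real.pi_pos])
  have hsb : 0 < Real.sin β := Real.sin_pos_of_pos_of_lt_pi hβ.1 (by linarith [hβ.2, Real.pi_pos])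
  have hca : 0 < Real.cos α := Real.cos_pos_of_mem_Ioo ⟨by linarith [hα.1, Real.pi_pos], hα.2⟩
  have hcb : 0 < Real.cos β := Real.cos_pos_of_mem_Ioo ⟨by linarith [hβ.1, Real.pi_pos], hβ.2⟩
  have hpyα := Real.sin_sq_add_cos_sq α
  have hpyβ := Real.sin_sq_add_cos_sq β
  rw [show 2 * α + 2 * β = 2 * (α + β) by ring, Real.sin_two_mul, Real.sin_two_mul,
    Real.sin_two_mul, Real.sin_add, Real.cos_add]
  generalize Real.sin α = sa at *
  generalize Real.sin β = sb at *
  generalize Real.cos α = ca at *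
  generalize Real.cos β = cb at *
  have hcosβ : cb ^ 2 = m / ((m : ℝ) + n) := by
    rw [show cb ^ 2 = 1 - sb ^ 2 by linarith, hsinβ]
    field_simp
    ring
  have hratio : (p : ℝ) / m = (sa / cb) ^ 2 := by
    rw [div_pow, hsinα, hcosβ]
    field_simp
  have hpn : (p : ℝ) / n = sa ^ 2 / sb ^ 2 := by
    rw [hsinα, hsinβ]
    field_simp
  have hnp : (n : ℝ) / p = sb ^ 2 / sa ^ 2 := by
    rw [hsinα, hsinβ]
    field_simp
  have hn4 : 16 * (n : ℝ) ^ 2 / ((m : ℝ) + n) ^ 2 = 16 * sb ^ 4 := by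
    rw [show sb ^ 4 = (sb ^ 2) ^ 2 by ring, hsinβ]
    field_simp
  rw [hn4, hpn, hratio]
  rw [hpn, hratio] at hμ
  rw [hnp, hratio] at hc2
  rw [hratio] at hc1
  have hr0 : 0 < sa / cb := by positivity
  have hr1 : sa / cb < 1 := by
    have h : (sa / cb) ^ 2 < 1 := by
      rw [← hratio, div_lt_one hmR]
      exact hpmR
    exact lt_of_pow_lt_pow_left₀ 2 zero_le_one (by simpa using h)
  obtain ⟨t, hrt, ht1, hct⟩ := exists_parameter hr0 hr1 hc1
  have ht0 := hr0.trans hrt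
  have ht2 : 0 < 1 - t ^ 2 := by nlinarith
  have hI := integral_pow_succ_mul_rhoMP hr0 hrt ht1 hct
  have hI1 := hI 0
  have hI2 := hI 1
  have hI3 := hI 2
  simp only [zero_add, pow_zero, pow_one, one_mul, integral_rhoMP hr0 hr1,
    sinSqPoisson_one ht0 ht1] at hI1
  simp only [Nat.reduceAdd, pow_one, hI1, sinSqPoisson_two ht0 ht1] at hI2
  simp only [Nat.reduceAdd, hc2, sinSqPoisson_three ht0 ht1] at hI3
  rw [hI1] at hμ
  rw [hI3]
  rw [hc2] at hI2
  have hct' : c * t * cb ^ 2 = (cb - sa * t) * (cb * t - sa) := by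
    rw [hct]
    field_simp
  have hquad : (cb * t - sa) ^ 2 = sb ^ 2 * (1 - t ^ 2) := by
    have h := hI2
    have hc' : c = (cb - sa * t) * (cb * t - sa) / (t * cb ^ 2) := by
      rw [← hct']
      field_simp
    rw [hc'] at h
    field_simp at h
    linear_combination -h
  have ht : t = sa * cb + ca * sb := by
    have hfac : (t - (sa * cb + ca * sb)) * (t - (sa * cb - ca * sb)) = 0 := by
      linear_combination hquad - t ^ 2 * hpyβ - sb ^ 2 * hpyα + sa ^ 2 * hpyβ
    rcases mul_eq_zero.1 hfac with h | h
    · linarith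
    · exfalso
      have h3 : sa < t * cb := (div_lt_iff₀ hcb).1 hrt
      have h4 : t * cb < sa * cb * cb := by
        have : 0 < ca * sb := by positivity
        exact mul_lt_mul_of_pos_right (by linarith) hcb
      have h5 : sa * cb * cb = sa - sa * sb ^ 2 := by linear_combination sa * hpyβ
      have h6 := mul_pos hsa (pow_pos hsb 2)
      linarith
  rw [← ht]
  set C := ca * cb - sa * sb with hC
  have hC2 : 1 - t ^ 2 = C ^ 2 := by
    rw [ht, hC]
    linear_combination (-(sb ^ 2 + cb ^ 2)) * hpyα - hpyβ
  have hC0 : C ≠ 0 := by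
    rintro h
    rw [h] at hC2
    linarith
  have hcC : c * t * cb ^ 2 = ca * sb * C ^ 2 := by
    have e1 : cb - sa * t = ca * C := by
      rw [ht, hC]
      linear_combination (-cb) * hpyα
    have e2 : cb * t - sa = sb * C := by
      rw [ht, hC]
      linear_combination sa * hpyβ
    rw [hct', e1, e2]
    ring
  have hc0 : c ≠ 0 := hc1.1.ne'
  have hμ' : μ = t * ca / (sb * c) := by
    rw [hμ]
    field_simp
    rw [ht]
    linear_combination (-sb ^ 2) * hpyα + sa ^ 2 * hpyβ
  have hM : 2 / Real.pi * (c ^ 2 * (t / (sa / cb)) ^ 3 * (Real.pi / (2 * (1 - t ^ 2) ^ 3)))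
      = t * ca ^ 2 * sb ^ 2 / (cb * sa ^ 3 * C ^ 2) := by
    have h : (c * t * cb ^ 2) ^ 2 = (ca * sb * C ^ 2) ^ 2 := by rw [hcC]
    rw [hC2]
    field_simp
    linear_combination h
  rw [hM, hμ']
  field_simp
  ring
end

section
/- Under Condition 3 with 0 < d₁ < 1, σ_p · (m/n^{1/3}) · σ_{J,p} → 1 as p → ∞. -/
open MeasureTheory Filter

theorem hasDerivAt_arcsin_div {q t : ℝ} (hq : 1 < q) (ht : t ∈ Set.Ioo (-1 : ℝ) 1) :
    HasDerivAt (fun t => Real.arcsin ((1 + q * t) / (t + q)))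
      (Real.sqrt (q ^ 2 - 1) / ((t + q) * Real.sqrt (1 - t ^ 2))) t := by
  obtain ⟨h1, h2⟩ := ht
  have hpos : 0 < t + q := by linarith
  have hq1 : 0 < q ^ 2 - 1 := by nlinarith
  have ht1 : 0 < 1 - t ^ 2 := by nlinarith
  have hlt : (1 + q * t) / (t + q) < 1 := by
    rw [div_lt_one hpos]; nlinarith
  have hgt : -1 < (1 + q * t) / (t + q) := by
    rw [lt_div_iff₀ hpos]; nlinarith
  have hin : HasDerivAt (fun t : ℝ => (1 + q * t) / (t + q)) ((q ^ 2 - 1) / (t + q) ^ 2) t := by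
    have := (((hasDerivAt_id t).const_mul q).const_add 1).div
      ((hasDerivAt_id t).add_const q) hpos.ne'
    refine this.congr_deriv ?_
    simp only [id]
    ring
  have h := (Real.hasDerivAt_arcsin hgt.ne' hlt.ne).comp t hin
  refine h.congr_deriv ?_
  have e1 : 1 - ((1 + q * t) / (t + q)) ^ 2 = (q ^ 2 - 1) * (1 - t ^ 2) / (t + q) ^ 2 := by
    field_simp
    ring
  rw [e1, Real.sqrt_div (by positivity), Real.sqrt_mul hq1.le, Real.sqrt_sq hpos.le]
  have hs := Real.sqrt_pos.2 hq1
  have hs' := Real.sqrt_pos.2 ht1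
  have hss := Real.sq_sqrt hq1.le
  field_simp
  linear_combination -hss

theorem hasDerivAt_sqrt_one_sub_sq {t : ℝ} (ht : t ∈ Set.Ioo (-1 : ℝ) 1) :
    HasDerivAt (fun t : ℝ => Real.sqrt (1 - t ^ 2)) (-t / Real.sqrt (1 - t ^ 2)) t := by
  have ht1 : 0 < 1 - t ^ 2 := by nlinarith [ht.1, ht.2]
  have h := (((hasDerivAt_id t).pow 2).const_sub 1).sqrt (by simpa using ht1.ne')
  refine h.congr_deriv ?_
  simp
  field_simp

theorem continuousOn_arcsin_div {q : ℝ} (hq : 1 < q) :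
    ContinuousOn (fun t => Real.arcsin ((1 + q * t) / (t + q))) (Set.Icc (-1) 1) := by
  refine Real.continuous_arcsin.comp_continuousOn (ContinuousOn.div (by fun_prop) (by fun_prop) ?_)
  intro t ht
  linarith [ht.1]

theorem continuousOn_sqrt_div_pow {q : ℝ} (hq : 1 < q) (k : ℕ) :
    ContinuousOn (fun t : ℝ => Real.sqrt (1 - t ^ 2) / (t + q) ^ k) (Set.Icc (-1) 1) := by
  refine ContinuousOn.div (by fun_prop) (by fun_prop) ?_
  intro t ht
  have : 0 < t + q := by linarith [ht.1]
  positivity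

theorem arcsin_div_endpoints {q : ℝ} (hq : 1 < q) :
    Real.arcsin ((1 + q * 1) / (1 + q)) = Real.pi / 2 ∧
      Real.arcsin ((1 + q * (-1)) / (-1 + q)) = -(Real.pi / 2) := by
  have h1 : (1 + q * 1) / (1 + q) = 1 := by
    rw [mul_one, div_self]; linarith
  have h2 : (1 + q * (-1)) / (-1 + q) = -1 := by
    rw [div_eq_iff] <;> linarith
  rw [h1, h2]
  simp

theorem intervalIntegrable_sqrt_div_pow {q : ℝ} (hq : 1 < q) (k : ℕ) :
    IntervalIntegrable (fun t : ℝ => Real.sqrt (1 - t ^ 2) / (t + q) ^ k) volume (-1) 1 := by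
  apply ContinuousOn.intervalIntegrable
  rw [Set.uIcc_of_le (by norm_num)]
  exact continuousOn_sqrt_div_pow hq k

theorem integral_sqrt_div_one {q : ℝ} (hq : 1 < q) :
    ∫ t in (-1 : ℝ)..1, Real.sqrt (1 - t ^ 2) / (t + q) ^ 1 =
      Real.pi * (q - Real.sqrt (q ^ 2 - 1)) := by
  have hq1 : 0 < q ^ 2 - 1 := by nlinarith
  rw [intervalIntegral.integral_eq_sub_of_hasDerivAt_of_le (by norm_num)
    (f := fun t => q * Real.arcsin t + Real.sqrt (1 - t ^ 2)
      - Real.sqrt (q ^ 2 - 1) * Real.arcsin ((1 + q * t) / (t + q))) ?_ ?_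
      (intervalIntegrable_sqrt_div_pow hq 1)]
  · rw [(arcsin_div_endpoints hq).1, (arcsin_div_endpoints hq).2]
    simp
    ring
  · have := continuousOn_arcsin_div hq
    have := Real.continuous_arcsin
    fun_prop
  · intro t ht
    have hpos : 0 < t + q := by linarith [ht.1]
    have ht1 : 0 < 1 - t ^ 2 := by nlinarith [ht.1, ht.2]
    have h := (((Real.hasDerivAt_arcsin ht.1.ne' ht.2.ne).const_mul q).add
      (hasDerivAt_sqrt_one_sub_sq ht)).sub
      ((hasDerivAt_arcsin_div hq ht).const_mul (Real.sqrt (q ^ 2 - 1)))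
    refine h.congr_deriv ?_
    have hs' := Real.sqrt_pos.2 ht1
    have hss := Real.sq_sqrt hq1.le
    have hss' := Real.sq_sqrt ht1.le
    field_simp
    linear_combination -hss' - hss

theorem integral_sqrt_div_sq {q : ℝ} (hq : 1 < q) :
    ∫ t in (-1 : ℝ)..1, Real.sqrt (1 - t ^ 2) / (t + q) ^ 2 =
      Real.pi * (q / Real.sqrt (q ^ 2 - 1) - 1) := by
  have hq1 : 0 < q ^ 2 - 1 := by nlinarith
  have hs := Real.sqrt_pos.2 hq1
  rw [intervalIntegral.integral_eq_sub_of_hasDerivAt_of_le (by norm_num)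
    (f := fun t => q / Real.sqrt (q ^ 2 - 1) * Real.arcsin ((1 + q * t) / (t + q))
      - Real.arcsin t - Real.sqrt (1 - t ^ 2) / (t + q) ^ 1) ?_ ?_
      (intervalIntegrable_sqrt_div_pow hq 2)]
  · rw [(arcsin_div_endpoints hq).1, (arcsin_div_endpoints hq).2]
    simp
    ring
  · have := continuousOn_arcsin_div hq
    have := Real.continuous_arcsin
    have := continuousOn_sqrt_div_pow hq 1
    fun_prop
  · intro t ht
    have hpos : 0 < t + q := by linarith [ht.1]
    have ht1 : 0 < 1 - t ^ 2 := by nlinarith [ht.1, ht.2]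
    have h := (((hasDerivAt_arcsin_div hq ht).const_mul (q / Real.sqrt (q ^ 2 - 1))).sub
      (Real.hasDerivAt_arcsin ht.1.ne' ht.2.ne)).sub
      ((hasDerivAt_sqrt_one_sub_sq ht).div (((hasDerivAt_id t).add_const q).pow 1)
        (by simpa using hpos.ne'))
    refine h.congr_deriv ?_
    have hs' := Real.sqrt_pos.2 ht1
    have hss' := Real.sq_sqrt ht1.le
    simp
    field_simp
    ring

theorem integral_sqrt_div_cube {q : ℝ} (hq : 1 < q) :
    ∫ t in (-1 : ℝ)..1, Real.sqrt (1 - t ^ 2) / (t + q) ^ 3 =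
      Real.pi / (2 * Real.sqrt (q ^ 2 - 1) ^ 3) := by
  have hq1 : 0 < q ^ 2 - 1 := by nlinarith
  have hs := Real.sqrt_pos.2 hq1
  rw [intervalIntegral.integral_eq_sub_of_hasDerivAt_of_le (by norm_num)
    (f := fun t => 1 / (2 * Real.sqrt (q ^ 2 - 1) ^ 3) * Real.arcsin ((1 + q * t) / (t + q))
      + q / (2 * (q ^ 2 - 1)) * (Real.sqrt (1 - t ^ 2) / (t + q) ^ 1)
      - 1 / 2 * (Real.sqrt (1 - t ^ 2) / (t + q) ^ 2)) ?_ ?_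
      (intervalIntegrable_sqrt_div_pow hq 3)]
  · rw [(arcsin_div_endpoints hq).1, (arcsin_div_endpoints hq).2]
    simp
    ring
  · have := continuousOn_arcsin_div hq
    have := continuousOn_sqrt_div_pow hq 1
    have := continuousOn_sqrt_div_pow hq 2
    fun_prop
  · intro t ht
    have hpos : 0 < t + q := by linarith [ht.1]
    have ht1 : 0 < 1 - t ^ 2 := by nlinarith [ht.1, ht.2]
    have h := (((hasDerivAt_arcsin_div hq ht).const_mul (1 / (2 * Real.sqrt (q ^ 2 - 1) ^ 3))).add
      (((hasDerivAt_sqrt_one_sub_sq ht).div (((hasDerivAt_id t).add_const q).pow 1)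
        (by simpa using hpos.ne')).const_mul (q / (2 * (q ^ 2 - 1))))).sub
      (((hasDerivAt_sqrt_one_sub_sq ht).div (((hasDerivAt_id t).add_const q).pow 2)
        (by simpa using hpos.ne')).const_mul (1 / 2))
    refine h.congr_deriv ?_
    have hs' := Real.sqrt_pos.2 ht1
    have hss := Real.sq_sqrt hq1.le
    have hss' := Real.sq_sqrt ht1.le
    simp
    generalize Real.sqrt (1 - t ^ 2) = r at *
    generalize Real.sqrt (q ^ 2 - 1) = s at *
    rw [← hss]
    field_simp
    rw [hss, hss']
    ring

theorem integral_semicircle_div_pow {δ μ c q : ℝ} (hδ : 0 < δ) (hc : c = μ - δ * q)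
    (k : ℕ) :
    ∫ x in (μ - δ)..(μ + δ), Real.sqrt ((μ + δ - x) * (x - (μ - δ))) / (x - c) ^ k =
      δ ^ 2 / δ ^ k * ∫ t in (-1 : ℝ)..1, Real.sqrt (1 - t ^ 2) / (t + q) ^ k := by
  have h := intervalIntegral.smul_integral_comp_mul_add (a := -1) (b := 1)
    (fun x => Real.sqrt ((μ + δ - x) * (x - (μ - δ))) / (x - c) ^ k) δ μ
  rw [show δ * (-1) + μ = μ - δ by ring, show δ * 1 + μ = μ + δ by ring] at h
  rw [← h, ← intervalIntegral.integral_const_mul, smul_eq_mul,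
    ← intervalIntegral.integral_const_mul]
  congr 1
  ext t
  rw [show (μ + δ - (δ * t + μ)) * (δ * t + μ - (μ - δ)) = δ ^ 2 * (1 - t ^ 2) by ring,
    Real.sqrt_mul (by positivity), Real.sqrt_sq hδ.le, hc,
    show δ * t + μ - (μ - δ * q) = δ * (t + q) by ring, mul_pow]
  rw [div_mul_div_comm]
  ring

/-- Moments of `1 / (x - c)` against the Marchenko–Pastur semicircle factor, in terms of the
parameter `y` that uniformizes the Stieltjes transform. -/
theorem integral_mp_div_pow {d y c : ℝ} (hd : 0 < d) (hy : 0 < y) (hdy : d * y ^ 2 < 1)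
    (hc : c = 1 + d - d * y - 1 / y) :
    (∫ x in aMP d..bMP d, Real.sqrt ((bMP d - x) * (x - aMP d)) / (x - c) ^ 1 =
      2 * Real.pi * d * y) ∧
    (∫ x in aMP d..bMP d, Real.sqrt ((bMP d - x) * (x - aMP d)) / (x - c) ^ 2 =
      2 * Real.pi * d * (y ^ 2 / (1 - d * y ^ 2))) ∧
    (∫ x in aMP d..bMP d, Real.sqrt ((bMP d - x) * (x - aMP d)) / (x - c) ^ 3 =
      2 * Real.pi * d * (y ^ 3 / (1 - d * y ^ 2) ^ 3)) := by
  set s := Real.sqrt d with hs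
  have hspos : 0 < s := Real.sqrt_pos.2 hd
  have hsd : d = s ^ 2 := (Real.sq_sqrt hd.le).symm
  have hsy : s * y < 1 := by
    by_contra! h
    nlinarith [sq_nonneg (s * y)]
  have ha : aMP d = (1 + d) - 2 * s := by
    unfold aMP; rw [← hs]; linear_combination -hsd
  have hb : bMP d = (1 + d) + 2 * s := by
    unfold bMP; rw [← hs]; linear_combination -hsd
  set q := (d * y ^ 2 + 1) / (2 * s * y) with hqdef
  have hq : 1 < q := by
    rw [hqdef, lt_div_iff₀ (by positivity)]
    rw [hsd]
    nlinarith [sq_pos_of_pos (sub_pos.2 hsy)]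
  have hcq : c = (1 + d) - 2 * s * q := by
    rw [hc, hqdef]
    field_simp
    ring
  have hsq : Real.sqrt (q ^ 2 - 1) = (1 - d * y ^ 2) / (2 * s * y) := by
    have := sub_pos.2 hdy
    rw [← Real.sqrt_sq (show 0 ≤ (1 - d * y ^ 2) / (2 * s * y) by positivity), hqdef]
    congr 1
    field_simp
    rw [hsd]
    ring
  have hne : 1 - d * y ^ 2 ≠ 0 := by linarith
  rw [ha, hb]
  refine ⟨?_, ?_, ?_⟩
  · rw [integral_semicircle_div_pow (by positivity) hcq, integral_sqrt_div_one hq, hsq, hqdef]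
    field_simp
    rw [hsd]
    ring
  · rw [integral_semicircle_div_pow (by positivity) hcq, integral_sqrt_div_sq hq, hsq, hqdef]
    field_simp
    ring
  · rw [integral_semicircle_div_pow (by positivity) hcq, integral_sqrt_div_cube hq, hsq]
    field_simp
    rw [hsd]

theorem integral_rhoMP_pow {d y c : ℝ} (hd : 0 < d) (hd1 : d < 1) (hy : 0 < y)
    (hdy : d * y ^ 2 < 1) (hc : c = 1 + d - d * y - 1 / y) (hca : c < aMP d) :
    (∫ x in aMP d..bMP d, (c / (x - c)) ^ 2 * rhoMP d x = (y - 1) ^ 2 / (1 - d * y ^ 2)) ∧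
    (∫ x in aMP d..bMP d, (c / (x - c)) ^ 3 * rhoMP d x =
      (y - 1) ^ 3 * (1 - d ^ 2 * y ^ 3) / (1 - d * y ^ 2) ^ 3) := by
  have hs1 : Real.sqrt d < 1 := by
    rw [Real.sqrt_lt' one_pos]; simpa using hd1
  have ha : 0 < aMP d := by
    unfold aMP
    have := sub_pos.2 hs1
    positivity
  have hab : aMP d ≤ bMP d := by
    unfold aMP bMP
    nlinarith [Real.sqrt_nonneg d]
  have hpi := Real.pi_pos
  obtain ⟨i1, i2, i3⟩ := integral_mp_div_pow hd hy hdy hc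
  have i0 := (integral_mp_div_pow hd one_pos (by simpa using hd1)
    (show (0 : ℝ) = 1 + d - d * 1 - 1 / 1 by ring)).1
  have hint : ∀ (z : ℝ) (k : ℕ), z < aMP d → IntervalIntegrable
      (fun x => Real.sqrt ((bMP d - x) * (x - aMP d)) / (x - z) ^ k) volume
      (aMP d) (bMP d) := by
    intro z k hz
    apply ContinuousOn.intervalIntegrable
    rw [Set.uIcc_of_le hab]
    refine ContinuousOn.div (by fun_prop) (by fun_prop) ?_
    intro x hx
    have : 0 < x - z := by linarith [hx.1]
    positivity
  have h0 := hint 0 1 ha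
  have h1 := hint c 1 hca
  have h2 := hint c 2 hca
  have h3 := hint c 3 hca
  have hne : 1 - d * y ^ 2 ≠ 0 := by linarith
  have hcy : c = (y - 1) * (1 - d * y) / y := by
    rw [hc]; field_simp; ring
  constructor
  · have hcongr : Set.EqOn (fun x => (c / (x - c)) ^ 2 * rhoMP d x)
        (fun x => 1 / (2 * Real.pi * d) *
          (c * (Real.sqrt ((bMP d - x) * (x - aMP d)) / (x - c) ^ 2)
            - Real.sqrt ((bMP d - x) * (x - aMP d)) / (x - c) ^ 1
            + Real.sqrt ((bMP d - x) * (x - aMP d)) / (x - 0) ^ 1))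
        (Set.uIcc (aMP d) (bMP d)) := by
      intro x hx
      rw [Set.uIcc_of_le hab] at hx
      have hx0 : x ≠ 0 := by linarith [hx.1]
      have hxc : x - c ≠ 0 := by linarith [hx.1]
      have hr : rhoMP d x =
          (1 / (2 * Real.pi * d * x)) * Real.sqrt ((bMP d - x) * (x - aMP d)) := if_pos hx
      simp only [hr, sub_zero]
      field_simp
      ring
    rw [intervalIntegral.integral_congr hcongr, intervalIntegral.integral_const_mul,
      intervalIntegral.integral_add ((h2.const_mul c).sub h1) h0,
      intervalIntegral.integral_sub (h2.const_mul c) h1,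
      intervalIntegral.integral_const_mul, i0, i1, i2, hcy]
    field_simp
    ring
  · have hcongr : Set.EqOn (fun x => (c / (x - c)) ^ 3 * rhoMP d x)
        (fun x => 1 / (2 * Real.pi * d) *
          (c ^ 2 * (Real.sqrt ((bMP d - x) * (x - aMP d)) / (x - c) ^ 3)
            - c * (Real.sqrt ((bMP d - x) * (x - aMP d)) / (x - c) ^ 2)
            + Real.sqrt ((bMP d - x) * (x - aMP d)) / (x - c) ^ 1
            - Real.sqrt ((bMP d - x) * (x - aMP d)) / (x - 0) ^ 1))
        (Set.uIcc (aMP d) (bMP d)) := by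
      intro x hx
      rw [Set.uIcc_of_le hab] at hx
      have hx0 : x ≠ 0 := by linarith [hx.1]
      have hxc : x - c ≠ 0 := by linarith [hx.1]
      have hr : rhoMP d x =
          (1 / (2 * Real.pi * d * x)) * Real.sqrt ((bMP d - x) * (x - aMP d)) := if_pos hx
      simp only [hr, sub_zero]
      field_simp
      ring
    rw [intervalIntegral.integral_congr hcongr, intervalIntegral.integral_const_mul,
      intervalIntegral.integral_sub (((h3.const_mul _).sub (h2.const_mul c)).add h1) h0,
      intervalIntegral.integral_add ((h3.const_mul _).sub (h2.const_mul c)) h1,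
      intervalIntegral.integral_sub (h3.const_mul _) (h2.const_mul c),
      intervalIntegral.integral_const_mul, intervalIntegral.integral_const_mul, i0, i1, i2, i3, hcy]
    field_simp
    ring

theorem exists_mp_parameter {d c : ℝ} (hd : 0 < d) (hd1 : d < 1) (hc : 0 < c) (hca : c < aMP d) :
    ∃ y, 1 < y ∧ d * y ^ 2 < 1 ∧ c = 1 + d - d * y - 1 / y := by
  set s := Real.sqrt d with hs
  have hspos : 0 < s := Real.sqrt_pos.2 hd
  have hsd : s ^ 2 = d := Real.sq_sqrt hd.le
  have hu : 2 * s < 1 + d - c := by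
    unfold aMP at hca
    rw [← hs] at hca
    nlinarith
  set u := 1 + d - c with hudef
  have hR : 0 < u ^ 2 - 4 * d := by nlinarith
  have hRp := Real.sqrt_pos.2 hR
  have hRs := Real.sq_sqrt hR.le
  set R := Real.sqrt (u ^ 2 - 4 * d)
  have hRu : R < u := by
    apply lt_of_pow_lt_pow_left₀ 2 (by linarith)
    linarith
  have hy : 0 < (u - R) / (2 * d) := div_pos (by linarith) (by linarith)
  have hdy : d * ((u - R) / (2 * d)) ^ 2 < 1 := by
    rw [show d * ((u - R) / (2 * d)) ^ 2 = (u - R) ^ 2 / (4 * d) by field_simp; ring,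
      div_lt_one (by linarith)]
    nlinarith
  have hcy : c = 1 + d - d * ((u - R) / (2 * d)) - 1 / ((u - R) / (2 * d)) := by
    have hne : u - R ≠ 0 := by linarith
    have hcu : c = 1 + d - u := by rw [hudef]; ring
    rw [hcu]
    field_simp
    linear_combination hRs
  refine ⟨(u - R) / (2 * d), ?_, hdy, hcy⟩
  generalize (u - R) / (2 * d) = y at hy hdy hcy
  by_contra! hle
  have : c * y = (y - 1) * (1 - d * y) := by
    rw [hcy]; field_simp; ring
  nlinarith [mul_pos hc hy, mul_nonneg (sub_nonneg.2 hle)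
    (show 0 ≤ 1 - d * y by nlinarith)]

/-- The reciprocal of the cubed scaling constant, in terms of `d = p / m` and `e = p / n`. -/
noncomputable def scalingInvCube (d e : ℝ) : ℝ :=
  (d + e) ^ 4 * (e + Real.sqrt (d + e - d * e)) ^ 4 /
    (Real.sqrt (d + e - d * e) * e ^ 2 * (Real.sqrt (d + e - d * e) - d) ^ 8)

theorem lt_sqrt_add_sub_mul {d e : ℝ} (hd : 0 < d) (hd1 : d < 1) (he : 0 < e) :
    d < Real.sqrt (d + e - d * e) := by
  apply Real.lt_sqrt_of_sq_lt
  nlinarith [mul_pos he (sub_pos.2 hd1), mul_pos hd (sub_pos.2 hd1)]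

theorem scalingInvCube_eq {d e c : ℝ} (hd : 0 < d) (hd1 : d < 1) (he : 0 < e)
    (hc : 0 < c) (hca : c < aMP d)
    (hint : ∫ x in aMP d..bMP d, (c / (x - c)) ^ 2 * rhoMP d x = 1 / e) :
    (1 / c ^ 3) * (1 + e * ∫ x in aMP d..bMP d, (c / (x - c)) ^ 3 * rhoMP d x) =
      scalingInvCube d e := by
  obtain ⟨y, hy1, hdy, hcy⟩ := exists_mp_parameter hd hd1 hc hca
  have hy : 0 < y := by linarith
  obtain ⟨i2, i3⟩ := integral_rhoMP_pow hd hd1 hy hdy hcy hca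
  rw [i2] at hint
  rw [i3]
  have hpos : 0 < 1 - d * y ^ 2 := by linarith
  rw [div_eq_div_iff hpos.ne' he.ne'] at hint
  have hw := lt_sqrt_add_sub_mul hd hd1 he
  unfold scalingInvCube
  have hwv : 0 ≤ d + e - d * e := by nlinarith [mul_pos he (sub_pos.2 hd1)]
  have hwy : (e + d) * y - e = Real.sqrt (d + e - d * e) := by
    rw [← Real.sqrt_sq (show 0 ≤ (e + d) * y - e by nlinarith)]
    congr 1
    linear_combination (d + e) * hint
  have hw2 := Real.sq_sqrt hwv
  generalize Real.sqrt (d + e - d * e) = w at hw hwy hw2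
  have h1d : (1 : ℝ) - d ≠ 0 := by linarith
  have hed : e = (w ^ 2 - d) / (1 - d) := by
    field_simp
    linear_combination -hw2
  have hwd : 0 < w + d := by linarith
  have hw0 : 0 < w := by linarith
  have hwd' : w - d ≠ 0 := by linarith
  have hyw : y = (1 + w) / (w + d) := by
    rw [eq_div_iff hwd.ne']
    have h2 : (w - d) * (w + d) = (e + d) * (1 - d) := by linear_combination hw2
    have h3 : (w - d) * (1 + w) = (e + w) * (1 - d) := by linear_combination hw2
    apply mul_left_cancel₀ hwd'
    linear_combination y * h2 - h3 + (1 - d) * hwy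
  have hw2d : w ^ 2 - d ≠ 0 := by
    intro h
    rw [h] at hed
    simp at hed
    linarith
  have e1 : y - 1 = (1 - d) / (w + d) := by rw [hyw]; field_simp; ring
  have e2 : 1 - d * y ^ 2 = (w ^ 2 - d) * (1 - d) / (w + d) ^ 2 := by
    rw [hyw]; field_simp; ring
  have e3 : c = w * (1 - d) ^ 2 / ((w + d) * (1 + w)) := by
    rw [hcy, hyw]; field_simp; ring
  have e4 : d + e = (w - d) * (w + d) / (1 - d) := by rw [hed]; field_simp; ring
  have e5 : e + w = (w - d) * (1 + w) / (1 - d) := by rw [hed]; field_simp; ring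
  rw [e1, e2, e3, e4, e5, hyw, hed]
  field_simp
  ring

/-- Johnstone's cubed scaling, up to the factor `1 / (m + n - 1) ^ 2`, as a function of
`sin² (γ / 2)` and `sin² (ψ / 2)`. -/
noncomputable def johnstoneCube (P Q : ℝ) : ℝ :=
  ((√P * √(1 - Q) + √(1 - P) * √Q) / (√(1 - P) * √(1 - Q) - √P * √Q)) ^ 6 * 16 /
    ((2 * √P * √(1 - P)) * (2 * √Q * √(1 - Q)) *
      (2 * (√P * √(1 - Q) + √(1 - P) * √Q) * (√(1 - P) * √(1 - Q) - √P * √Q)) ^ 2)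

theorem johnstoneCube_eq {γ ψ P Q K : ℝ} (hγ : γ ∈ Set.Ioo 0 Real.pi)
    (hψ : ψ ∈ Set.Ioo 0 Real.pi) (hP : Real.sin (γ / 2) ^ 2 = P) (hQ : Real.sin (ψ / 2) ^ 2 = Q) :
    (Real.tan ((γ + ψ) / 2) ^ 2) ^ 3 * (16 / K ^ 2) *
        (1 / (Real.sin γ * Real.sin ψ * Real.sin (γ + ψ) ^ 2)) = johnstoneCube P Q / K ^ 2 := by
  have key : ∀ {θ A : ℝ}, θ ∈ Set.Ioo 0 Real.pi → Real.sin (θ / 2) ^ 2 = A →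
      √A = Real.sin (θ / 2) ∧ √(1 - A) = Real.cos (θ / 2) := by
    rintro θ A ⟨h0, h1⟩ rfl
    constructor
    · exact Real.sqrt_sq (Real.sin_nonneg_of_nonneg_of_le_pi (by linarith) (by linarith))
    · rw [← Real.cos_sq']
      exact Real.sqrt_sq (Real.cos_nonneg_of_neg_pi_div_two_le_of_le (by linarith) (by linarith))
  obtain ⟨p1, p2⟩ := key hγ hP
  obtain ⟨q1, q2⟩ := key hψ hQ
  have s1 : Real.sin γ = 2 * Real.sin (γ / 2) * Real.cos (γ / 2) := by
    rw [← Real.sin_two_mul]; ring_nf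
  have s2 : Real.sin ψ = 2 * Real.sin (ψ / 2) * Real.cos (ψ / 2) := by
    rw [← Real.sin_two_mul]; ring_nf
  have s3 : Real.sin (γ + ψ) = 2 * Real.sin (γ / 2 + ψ / 2) * Real.cos (γ / 2 + ψ / 2) := by
    rw [← Real.sin_two_mul]; ring_nf
  rw [show (γ + ψ) / 2 = γ / 2 + ψ / 2 by ring, Real.tan_eq_sin_div_cos, s1, s2, s3,
    Real.sin_add, Real.cos_add, johnstoneCube, p1, p2, q1, q2]
  ring

theorem johnstoneCube_comm (P Q : ℝ) : johnstoneCube P Q = johnstoneCube Q P := by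
  unfold johnstoneCube
  ring_nf

theorem sqrt_johnstone_limits {d e : ℝ} (hd : 0 < d) (hd1 : d < 1) (he : 0 < e) :
    √(d * e / (d + e)) = √d * √e / √(d + e) ∧
    √(1 - d * e / (d + e)) = √(d + e - d * e) / √(d + e) ∧
    √(d / (d + e)) = √d / √(d + e) ∧ √(1 - d / (d + e)) = √e / √(d + e) := by
  have hde : 0 < d + e := by linarith
  have hwv : 0 ≤ d + e - d * e := by nlinarith [mul_pos he (sub_pos.2 hd1)]
  rw [← Real.sqrt_mul hd.le, ← Real.sqrt_div (by positivity), ← Real.sqrt_div hwv,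
    ← Real.sqrt_div hd.le, ← Real.sqrt_div he.le]
  refine ⟨rfl, ?_, rfl, ?_⟩ <;> congr 1 <;> field_simp
  ring

theorem johnstoneCube_limit {d e : ℝ} (hd : 0 < d) (hd1 : d < 1) (he : 0 < e) :
    e ^ 3 / (d * (d + e) ^ 2) * johnstoneCube (d * e / (d + e)) (d / (d + e)) =
      scalingInvCube d e := by
  obtain ⟨h1, h2, h3, h4⟩ := sqrt_johnstone_limits hd hd1 he
  have hw := lt_sqrt_add_sub_mul hd hd1 he
  unfold johnstoneCube scalingInvCube
  rw [h1, h2, h3, h4]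
  have ha := Real.sqrt_pos.2 hd
  have hb := Real.sqrt_pos.2 he
  have hg := Real.sqrt_pos.2 (show 0 < d + e by linarith)
  have ha2 := Real.sq_sqrt hd.le
  have hb2 := Real.sq_sqrt he.le
  have hg2 := Real.sq_sqrt (show 0 ≤ d + e by linarith)
  generalize √(d + e - d * e) = w at *
  generalize √(d + e) = g at *
  rw [← hg2]
  generalize √d = a at *
  generalize √e = b at *
  subst ha2 hb2
  have hw0 : 0 < w := lt_trans hd hw
  have hwd : w - a ^ 2 ≠ 0 := by linarith
  have hS : a * b / g * (b / g) + w / g * (a / g) = a * (b ^ 2 + w) / g ^ 2 := by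
    field_simp
  have hC : w / g * (b / g) - a * b / g * (a / g) = b * (w - a ^ 2) / g ^ 2 := by
    field_simp
  rw [hS, hC]
  field_simp
  ring

theorem tendsto_johnstoneCube {d e : ℝ} (hd : 0 < d) (hd1 : d < 1) (he : 0 < e)
    {P Q : ℕ → ℝ} (hP : Tendsto P atTop (nhds (d * e / (d + e))))
    (hQ : Tendsto Q atTop (nhds (d / (d + e)))) :
    Tendsto (fun p => johnstoneCube (P p) (Q p)) atTop
      (nhds (johnstoneCube (d * e / (d + e)) (d / (d + e)))) := by
  obtain ⟨h1, h2, h3, h4⟩ := sqrt_johnstone_limits hd hd1 he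
  have hw := lt_sqrt_add_sub_mul hd hd1 he
  have hw0 : 0 < √(d + e - d * e) := lt_trans hd hw
  have ha := Real.sqrt_pos.2 hd
  have hb := Real.sqrt_pos.2 he
  have hg := Real.sqrt_pos.2 (show 0 < d + e by linarith)
  have ha2 := Real.sq_sqrt hd.le
  have tP := hP.sqrt
  have tQ := hQ.sqrt
  have tP' := (hP.const_sub 1).sqrt
  have tQ' := (hQ.const_sub 1).sqrt
  have hC : 0 < √(1 - d * e / (d + e)) * √(1 - d / (d + e))
      - √(d * e / (d + e)) * √(d / (d + e)) := by
    rw [h1, h2, h3, h4]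
    have : √(d + e - d * e) / √(d + e) * (√e / √(d + e)) - √d * √e / √(d + e) * (√d / √(d + e))
        = √e * (√(d + e - d * e) - d) / √(d + e) ^ 2 := by
      field_simp
      rw [ha2]
    rw [this]
    have := sub_pos.2 hw
    positivity
  have hP0 : 0 < √(d * e / (d + e)) := by rw [h1]; positivity
  have hP1 : 0 < √(1 - d * e / (d + e)) := by rw [h2]; positivity
  have hQ0 : 0 < √(d / (d + e)) := by rw [h3]; positivity
  have hQ1 : 0 < √(1 - d / (d + e)) := by rw [h4]; positivity
  unfold johnstoneCube
  have tS := (tP.mul tQ').add (tP'.mul tQ)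
  have tC := (tP'.mul tQ').sub (tP.mul tQ)
  exact (((tS.div tC hC.ne').pow 6).mul_const 16).div
    ((((tP.const_mul 2).mul tP').mul ((tQ.const_mul 2).mul tQ')).mul
      (((tS.const_mul 2).mul tC).pow 2)) (by positivity)

theorem tendsto_scalingInvCube {d e : ℝ} (hd : 0 < d) (hd1 : d < 1) (he : 0 < e)
    {u v : ℕ → ℝ} (hu : Tendsto u atTop (nhds d)) (hv : Tendsto v atTop (nhds e)) :
    Tendsto (fun p => scalingInvCube (u p) (v p)) atTop (nhds (scalingInvCube d e)) := by
  have hw := lt_sqrt_add_sub_mul hd hd1 he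
  have hw0 : 0 < √(d + e - d * e) := lt_trans hd hw
  have := sub_pos.2 hw
  have tw := ((hu.add hv).sub (hu.mul hv)).sqrt
  exact (((hu.add hv).pow 4).mul ((hv.add tw).pow 4)).div
    ((tw.mul (hv.pow 2)).mul ((tw.sub hu).pow 8)) (by positivity)

theorem scalingInvCube_pos {d e : ℝ} (hd : 0 < d) (hd1 : d < 1) (he : 0 < e) :
    0 < scalingInvCube d e := by
  have hw := lt_sqrt_add_sub_mul hd hd1 he
  have hw0 : 0 < √(d + e - d * e) := lt_trans hd hw
  have := sub_pos.2 hw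
  unfold scalingInvCube
  positivity

/-- under Condition 3 with `0 < d₁ < 1`,
`σ_p · (m/n^{1/3}) · σ_{J,p} → 1` as `p → ∞`. -/
theorem stmt_6 (m n : ℕ → ℕ) (d₁ d₂ d₃ : ℝ)
    (hd₁ : d₁ ∈ Set.Ioo (0 : ℝ) 1) (hd₂ : 0 < d₂) (hd₃ : d₃ ∈ Set.Ioo (0 : ℝ) 1)
    (hm : Tendsto (fun p : ℕ => (p : ℝ) / m p) atTop (nhds d₁))
    (hn : Tendsto (fun p : ℕ => (p : ℝ) / n p) atTop (nhds d₂))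
    (hmn : Tendsto (fun p : ℕ => (p : ℝ) / ((m p : ℝ) + n p)) atTop (nhds d₃))
    (c : ℕ → ℝ)
    (hc : ∀ᶠ p : ℕ in atTop,
      c p ∈ Set.Ioo 0 (aMP ((p : ℝ) / m p)) ∧
      (∫ x in (aMP ((p : ℝ) / m p))..(bMP ((p : ℝ) / m p)),
          (c p / (x - c p)) ^ 2 * rhoMP ((p : ℝ) / m p) x) = (n p : ℝ) / p)
    (σ : ℕ → ℝ)
    (hσ : ∀ᶠ p : ℕ in atTop, 0 < σ p ∧
      1 / σ p ^ 3 = (1 / c p ^ 3) * (1 + ((p : ℝ) / n p) *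
        ∫ x in (aMP ((p : ℝ) / m p))..(bMP ((p : ℝ) / m p)),
          (c p / (x - c p)) ^ 3 * rhoMP ((p : ℝ) / m p) x))
    (γ ψ : ℕ → ℝ)
    (hγ : ∀ᶠ p : ℕ in atTop, γ p ∈ Set.Ioo 0 Real.pi ∧
      Real.sin (γ p / 2) ^ 2 = ((min p (n p) : ℝ) - 1 / 2) / ((m p : ℝ) + n p - 1))
    (hψ : ∀ᶠ p : ℕ in atTop, ψ p ∈ Set.Ioo 0 Real.pi ∧
      Real.sin (ψ p / 2) ^ 2 = ((max p (n p) : ℝ) - 1 / 2) / ((m p : ℝ) + n p - 1))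
    (μJ : ℕ → ℝ)
    (hμJ : ∀ p, μJ p = Real.tan ((γ p + ψ p) / 2) ^ 2)
    (σJ : ℕ → ℝ)
    (hσJ : ∀ᶠ p : ℕ in atTop, 0 < σJ p ∧
      σJ p ^ 3 = μJ p ^ 3 * (16 / ((m p : ℝ) + n p - 1) ^ 2) *
        (1 / (Real.sin (γ p) * Real.sin (ψ p) * Real.sin (γ p + ψ p) ^ 2))) :
    Tendsto (fun p : ℕ => σ p * ((m p : ℝ) / (n p : ℝ) ^ ((1 : ℝ) / 3)) * σJ p)
      atTop (nhds 1) := by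
  obtain ⟨hd, hd1⟩ := hd₁
  have hd0 : ∀ᶠ p : ℕ in atTop, (p : ℝ) / m p ∈ Set.Ioo (0 : ℝ) 1 :=
    hm.eventually (Ioo_mem_nhds hd hd1)
  have he0 : ∀ᶠ p : ℕ in atTop, 0 < (p : ℝ) / n p := hn.eventually (lt_mem_nhds hd₂)
  have hinv : Tendsto (fun p : ℕ => 1 / (p : ℝ)) atTop (nhds 0) :=
    tendsto_one_div_atTop_nhds_zero_nat
  have tK : Tendsto (fun p : ℕ => (p : ℝ) / ((m p : ℝ) + n p - 1)) atTop
      (nhds (d₁ * d₂ / (d₁ + d₂))) := by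
    have h := ((hm.inv₀ hd.ne').add (hn.inv₀ hd₂.ne')).sub hinv
    have hne : d₁⁻¹ + d₂⁻¹ - 0 ≠ 0 := by
      rw [sub_zero]
      positivity
    have h' := h.inv₀ hne
    rw [show (d₁⁻¹ + d₂⁻¹ - 0)⁻¹ = d₁ * d₂ / (d₁ + d₂) by
      rw [sub_zero]
      field_simp
      ring] at h'
    refine h'.congr' ?_
    filter_upwards [eventually_gt_atTop 0] with p hp
    have hp' : (0 : ℝ) < p := by exact_mod_cast hp
    rw [inv_div, inv_div, ← add_div, ← sub_div, inv_div]
  have tP : Tendsto (fun p : ℕ => ((p : ℝ) - 1 / 2) / ((m p : ℝ) + n p - 1)) atTop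
      (nhds (d₁ * d₂ / (d₁ + d₂))) := by
    have h := tK.mul ((hinv.const_mul (1 / 2)).const_sub 1)
    rw [show d₁ * d₂ / (d₁ + d₂) * (1 - 1 / 2 * 0) = d₁ * d₂ / (d₁ + d₂) by ring] at h
    refine h.congr' ?_
    filter_upwards [eventually_gt_atTop 0] with p hp
    have hp' : (0 : ℝ) < p := by exact_mod_cast hp
    rw [div_mul_eq_mul_div]
    congr 1
    field_simp
  have tQ : Tendsto (fun p : ℕ => ((n p : ℝ) - 1 / 2) / ((m p : ℝ) + n p - 1)) atTop
      (nhds (d₁ / (d₁ + d₂))) := by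
    have h := tK.mul ((hn.inv₀ hd₂.ne').sub (hinv.const_mul (1 / 2)))
    rw [show d₁ * d₂ / (d₁ + d₂) * (d₂⁻¹ - 1 / 2 * 0) = d₁ / (d₁ + d₂) by field_simp; ring] at h
    refine h.congr' ?_
    filter_upwards [eventually_gt_atTop 0] with p hp
    have hp' : (0 : ℝ) < p := by exact_mod_cast hp
    rw [div_mul_eq_mul_div, inv_div]
    congr 1
    field_simp
  have hS := scalingInvCube_pos hd hd1 hd₂
  have tmain := (((tendsto_scalingInvCube hd hd1 hd₂ hm hn).inv₀ hS.ne').mul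
    (((hn.mul (tK.pow 2)).div (hm.pow 3) (by positivity)))).mul
    (tendsto_johnstoneCube hd hd1 hd₂ tP tQ)
  have hlim : (scalingInvCube d₁ d₂)⁻¹ * (d₂ * (d₁ * d₂ / (d₁ + d₂)) ^ 2 / d₁ ^ 3) *
      johnstoneCube (d₁ * d₂ / (d₁ + d₂)) (d₁ / (d₁ + d₂)) = 1 := by
    rw [show d₂ * (d₁ * d₂ / (d₁ + d₂)) ^ 2 / d₁ ^ 3 = d₂ ^ 3 / (d₁ * (d₁ + d₂) ^ 2) by
      field_simp, mul_assoc, johnstoneCube_limit hd hd1 hd₂, inv_mul_cancel₀ hS.ne']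
  rw [hlim] at tmain
  have troot := tmain.rpow_const (p := 1 / 3) (Or.inl one_ne_zero)
  rw [Real.one_rpow] at troot
  refine troot.congr' ?_
  filter_upwards [hd0, he0, hc, hσ, hγ, hψ, hσJ, eventually_gt_atTop 0] with
    p hd0 he0 hc hσ hγ hψ hσJ hp
  have hp' : (0 : ℝ) < p := by exact_mod_cast hp
  have hm0 : (0 : ℝ) < m p := (div_pos_iff_of_pos_left hp').1 hd0.1
  have hn0 : (0 : ℝ) < n p := (div_pos_iff_of_pos_left hp').1 he0
  have hσ3 : σ p ^ 3 = (scalingInvCube ((p : ℝ) / m p) ((p : ℝ) / n p))⁻¹ := by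
    rw [← scalingInvCube_eq hd0.1 hd0.2 he0 hc.1.1 hc.1.2 (by rw [hc.2, one_div_div]),
      ← hσ.2, one_div, inv_inv]
  have hσJ3 : σJ p ^ 3 = johnstoneCube (((p : ℝ) - 1 / 2) / ((m p : ℝ) + n p - 1))
      (((n p : ℝ) - 1 / 2) / ((m p : ℝ) + n p - 1)) / ((m p : ℝ) + n p - 1) ^ 2 := by
    rw [hσJ.2, hμJ, johnstoneCube_eq hγ.1 hψ.1 hγ.2 hψ.2]
    rcases le_total (p : ℝ) (n p) with h | h
    · rw [min_eq_left h, max_eq_right h]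
    · rw [min_eq_right h, max_eq_left h, johnstoneCube_comm]
  have hroot : ((n p : ℝ) ^ ((1 : ℝ) / 3)) ^ 3 = n p := by
    rw [← Real.rpow_natCast, ← Real.rpow_mul hn0.le]
    norm_num
  have hX : 0 ≤ σ p * ((m p : ℝ) / (n p : ℝ) ^ ((1 : ℝ) / 3)) * σJ p := by
    have := hσ.1
    have := hσJ.1
    positivity
  rw [← Real.pow_rpow_inv_natCast hX three_ne_zero]
  have hcube : (σ p * ((m p : ℝ) / (n p : ℝ) ^ ((1 : ℝ) / 3)) * σJ p) ^ 3 =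
      σ p ^ 3 * ((m p : ℝ) ^ 3 / n p) * σJ p ^ 3 := by
    rw [mul_pow, mul_pow, div_pow, hroot]
  rw [hcube, hσ3, hσJ3]
  have hmid : (p : ℝ) / n p * ((p : ℝ) / ((m p : ℝ) + n p - 1)) ^ 2 / ((p : ℝ) / m p) ^ 3 =
      (m p : ℝ) ^ 3 / n p / ((m p : ℝ) + n p - 1) ^ 2 := by
    generalize (m p : ℝ) + n p - 1 = K
    field_simp
  rw [Pi.div_apply, hmid]
  norm_num
  congr 1
  ring
end
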